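/- arXiv:1010.4496 — 3 statements merged into one kernel-verified Lean document; each statement's English description precedes it below -/
import Mathlib

section
/- There exist an irrational number α ∈ ℝ, a radius r > 0, and a holomorphic injective map f defined on an open neighborhood of the closed disk D̄_r with f(0) = 0 and f'(0) = e^{2πiα}, such that f is non-linearizable and f admits a hedgehog K on D̄_r whose fixed point 0 is inaccessible from ℂ ∖ K. -/
open Complex Metric Set Filter

noncomputable section

/-- `f` is linearizable at the origin with rotation number `α`. -/
def Linearizable (α : ℝ) (f : ℂ → ℂ) : Prop :=
  ∃ (h : ℂ → ℂ) (V : Set ℂ), IsOpen V ∧ (0 : ℂ) ∈ V ∧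
    DifferentiableOn ℂ h V ∧ Set.InjOn h V ∧ h 0 = 0 ∧
    ∀ᶠ z in nhds (0 : ℂ), f (h z) = h (Complex.exp (2 * Real.pi * Complex.I * α) * z)

/-- `K` is a hedgehog for `f` on the closed disk of radius `r`. -/
def IsHedgehog (r : ℝ) (f : ℂ → ℂ) (K : Set ℂ) : Prop :=
  IsCompact K ∧ IsConnected K ∧ (0 : ℂ) ∈ K ∧ K ⊆ Metric.closedBall 0 r ∧
    (K ∩ Metric.sphere 0 r).Nonempty ∧ f '' K = K ∧ IsConnected Kᶜ

/-- `p` is accessible from `ℂ ∖ K`: there is a continuous path ending at `p` whose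
points before time `1` all lie outside `K`. -/
def AccessiblePoint (K : Set ℂ) (p : ℂ) : Prop :=
  ∃ γ : ℝ → ℂ, ContinuousOn γ (Set.Icc 0 1) ∧ γ 1 = p ∧
    ∀ t ∈ Set.Ico (0 : ℝ) 1, γ t ∉ K

theorem exp_fiber_constant {X : Type*} [TopologicalSpace X] {S : Set X} (hS : IsPreconnected S)
    {h : X → ℂ} (hc : ContinuousOn h S) {c : ℂ} (he : ∀ x ∈ S, exp (h x) = c)
    {x y : X} (hx : x ∈ S) (hy : y ∈ S) : h x = h y := by
  have key : ∀ z ∈ S, ∃ n : ℤ, h z = h x + n * (2 * Real.pi * I) := fun z hz =>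
    Complex.exp_eq_exp_iff_exists_int.1 ((he z hz).trans (he x hx).symm)
  have h1 : ContinuousOn (fun z => (h z - h x).im / (2 * Real.pi)) S := by fun_prop
  have h2 : MapsTo (fun z => (h z - h x).im / (2 * Real.pi)) S (range ((↑) : ℤ → ℝ)) := by
    intro z hz
    obtain ⟨n, hn⟩ := key z hz
    refine ⟨n, ?_⟩
    have : (2 * Real.pi) ≠ 0 := by positivity
    simp only [hn]
    field_simp
    simp
  have : DiscreteTopology (range ((↑) : ℤ → ℝ)) := by
    have := Int.isClosedEmbedding_coe_real.isEmbedding.toHomeomorph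
    exact this.discreteTopology
  have h3 := hS.constant_of_mapsTo ⟨this⟩ h1 h2 hx hy
  obtain ⟨n, hn⟩ := key y hy
  have h4 : (n : ℝ) = 0 := by
    have : (2 * Real.pi) ≠ 0 := by positivity
    simp only [hn] at h3
    field_simp at h3
    simp at h3
    simpa using h3
  have : n = 0 := by exact_mod_cast h4
  simp [hn, this]

theorem exists_continuous_log {X : Type*} [TopologicalSpace X] [SimplyConnectedSpace X]
    [LocallyPathConnectedSpace X] {g : X → ℂ} (hg : Continuous g) (h0 : ∀ x, g x ≠ 0) :
    ∃ L : X → ℂ, Continuous L ∧ ∀ x, exp (L x) = g x := by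
  obtain ⟨L, hL, hL'⟩ := Complex.exists_continuousOn_eqOn_exp_comp (U := (univ : Set X))
    ((Homeomorph.Set.univ X).toHomotopyEquiv.simplyConnectedSpace_iff.2 inferInstance)
    isOpen_univ hg.continuousOn (by simpa using h0)
  exact ⟨L, continuousOn_univ.1 hL, fun x => hL' (mem_univ x)⟩

theorem log_neg_of_im_pos {z : ℂ} (h : 0 < z.im) : log (-z) = log z - Real.pi * I := by
  simp [Complex.log, Complex.arg_neg_eq_arg_sub_pi_of_im_pos h]; ring

theorem log_neg_of_im_neg {z : ℂ} (h : z.im < 0) : log (-z) = log z + Real.pi * I := by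
  simp [Complex.log, Complex.arg_neg_eq_arg_add_pi_of_im_neg h]; ring

/-- A two-dimensional intermediate value theorem of Poincaré–Miranda type. -/
theorem exists_zero_of_sides {D : ℝ → ℝ → ℂ} {a b c d : ℝ} (hab : a ≤ b) (hcd : c ≤ d)
    (hD : ContinuousOn (fun x : ℝ × ℝ => D x.1 x.2) (Icc a b ×ˢ Icc c d))
    (ha : ∀ t ∈ Icc c d, (D a t).im < 0) (hb : ∀ t ∈ Icc c d, 0 < (D b t).im)
    (hc : ∀ s ∈ Icc a b, (D s c).re < 0) (hd : ∀ s ∈ Icc a b, 0 < (D s d).re) :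
    ∃ s ∈ Icc a b, ∃ t ∈ Icc c d, D s t = 0 := by
  by_contra! hne
  obtain ⟨L, hL, hL'⟩ := exists_continuous_log
    (g := fun x : ℝ × ℝ => D (projIcc a b hab x.1) (projIcc c d hcd x.2))
    (hD.comp_continuous (f := fun x : ℝ × ℝ => ((projIcc a b hab x.1 : ℝ),
      (projIcc c d hcd x.2 : ℝ))) (by fun_prop)
      (fun x => ⟨(projIcc a b hab x.1).2, (projIcc c d hcd x.2).2⟩))
    (fun x => hne _ (projIcc a b hab x.1).2 _ (projIcc c d hcd x.2).2)
  have hL2 : ∀ s ∈ Icc a b, ∀ t ∈ Icc c d, exp (L (s, t)) = D s t := by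
    intro s hs t ht
    rw [hL']; simp [projIcc_of_mem, hs, ht]
  have key : ∀ (S : Set (ℝ × ℝ)), IsPreconnected S → S ⊆ Icc a b ×ˢ Icc c d →
      ∀ σ : ℂ, σ ≠ 0 → (∀ x ∈ S, σ * D x.1 x.2 ∈ slitPlane) → ∀ x ∈ S, ∀ y ∈ S,
      L x - log (σ * D x.1 x.2) = L y - log (σ * D y.1 y.2) := by
    intro S hS hsub σ hσ hsl x hx y hy
    refine exp_fiber_constant hS (h := fun x => L x - log (σ * D x.1 x.2)) (c := σ⁻¹) ?_ ?_ hx hy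
    · exact hL.continuousOn.sub (((hD.mono hsub).const_smul σ).clog hsl)
    · rintro ⟨s, t⟩ hz
      have h0 := hne s (hsub hz).1 t (hsub hz).2
      rw [Complex.exp_sub, hL2 s (hsub hz).1 t (hsub hz).2, Complex.exp_log (by simp [hσ, h0])]
      field_simp
  have hA : a ∈ Icc a b := ⟨le_rfl, hab⟩
  have hB : b ∈ Icc a b := ⟨hab, le_rfl⟩
  have hC : c ∈ Icc c d := ⟨le_rfl, hcd⟩
  have hDD : d ∈ Icc c d := ⟨hcd, le_rfl⟩
  have pv : ∀ s, IsPreconnected (({s} : Set ℝ) ×ˢ Icc c d) := fun s =>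
    isPreconnected_singleton.prod isPreconnected_Icc
  have ph : ∀ t, IsPreconnected (Icc a b ×ˢ ({t} : Set ℝ)) := fun s =>
    isPreconnected_Icc.prod isPreconnected_singleton
  have sv : ∀ s ∈ Icc a b, (({s} : Set ℝ) ×ˢ Icc c d) ⊆ Icc a b ×ˢ Icc c d := fun s hs =>
    prod_mono (singleton_subset_iff.2 hs) le_rfl
  have sh : ∀ t ∈ Icc c d, (Icc a b ×ˢ ({t} : Set ℝ)) ⊆ Icc a b ×ˢ Icc c d := fun s hs =>
    prod_mono le_rfl (singleton_subset_iff.2 hs)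
  have k1 := key _ (pv b) (sv b hB) 1 one_ne_zero
    (by rintro ⟨s, t⟩ ⟨rfl, ht⟩
        simpa [mem_slitPlane_iff] using Or.inr (hb t ht).ne')
    (b, c) ⟨rfl, hC⟩ (b, d) ⟨rfl, hDD⟩
  have k2 := key _ (pv a) (sv a hA) 1 one_ne_zero
    (by rintro ⟨s, t⟩ ⟨rfl, ht⟩
        simpa [mem_slitPlane_iff] using Or.inr (ha t ht).ne)
    (a, c) ⟨rfl, hC⟩ (a, d) ⟨rfl, hDD⟩
  have k3 := key _ (ph d) (sh d hDD) 1 one_ne_zero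
    (by rintro ⟨s, t⟩ ⟨ht, rfl⟩
        simpa [mem_slitPlane_iff] using Or.inl (hd s ht))
    (a, d) ⟨hA, rfl⟩ (b, d) ⟨hB, rfl⟩
  have k4 := key _ (ph c) (sh c hC) (-1) (by simp)
    (by rintro ⟨s, t⟩ ⟨ht, rfl⟩
        simpa [mem_slitPlane_iff] using Or.inl (b := (D s t).im ≠ 0) (hc s ht))
    (a, c) ⟨hA, rfl⟩ (b, c) ⟨hB, rfl⟩
  simp only [one_mul, neg_mul, log_neg_of_im_pos (hb c hC), log_neg_of_im_neg (ha c hC)]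
    at k1 k2 k3 k4
  have : (2 * Real.pi * I : ℂ) = 0 := by linear_combination -k4 - k1 + k2 + k3
  simp [Real.pi_ne_zero] at this

theorem continuousMap_exp_mem {X : Type*} [TopologicalSpace X] [CompactSpace X]
    {A : Subalgebra ℂ C(X, ℂ)} (hA : IsClosed (A : Set C(X, ℂ))) {h : C(X, ℂ)} (hh : h ∈ A) :
    ∃ g ∈ A, ∀ x, g x = exp (h x) := by
  refine ⟨NormedSpace.exp h, NormedSpace.exp_mem hA hh, fun x => ?_⟩
  have := NormedSpace.map_exp (ContinuousMap.evalCLM (M := ℂ) ℂ x |>.toLinearMap |> fun l =>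
    (Pi.evalRingHom (fun _ : X => ℂ) x).comp (ContinuousMap.coeFnRingHom : C(X, ℂ) →+* (X → ℂ)))
    (by exact (ContinuousMap.evalCLM (M := ℂ) ℂ x).continuous) h
  rw [Complex.exp_eq_exp_ℂ]
  exact this

theorem continuousMap_log_mem {X : Type*} [TopologicalSpace X] [CompactSpace X]
    {A : Subalgebra ℂ C(X, ℂ)} (hA : IsClosed (A : Set C(X, ℂ))) {u : C(X, ℂ)} (hu : u ∈ A)
    (hb : ∀ x, ‖u x‖ ≤ 1 / 2) :
    ∃ g ∈ A, ∀ x, exp (g x) = 1 + u x := by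
  have hn : ‖u‖ ≤ 1 / 2 := (ContinuousMap.norm_le _ (by norm_num)).2 hb
  set v : ℕ → C(X, ℂ) := fun n => ((-1) ^ (n + 1) / n : ℂ) • u ^ n with hv
  have hvm : ∀ n, v n ∈ A := fun n => A.smul_mem (A.pow_mem hu n) _
  have hs : Summable v := by
    refine Summable.of_norm_bounded (g := fun n : ℕ => (1 / 2 : ℝ) ^ n)
      (summable_geometric_of_lt_one (by norm_num) (by norm_num)) fun n => ?_
    rw [ContinuousMap.norm_le _ (by positivity)]
    intro x
    simp only [hv, ContinuousMap.smul_apply, ContinuousMap.pow_apply, smul_eq_mul, norm_mul,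
      norm_div, norm_pow, norm_neg, norm_one, one_pow, Complex.norm_natCast]
    have h1 : (1 / (n : ℝ)) ≤ 1 := by
      rcases Nat.eq_zero_or_pos n with rfl | h
      · simp
      · rw [div_le_one (by positivity)]; exact_mod_cast h
    calc (1 / (n : ℝ)) * ‖u x‖ ^ n ≤ 1 * (1 / 2) ^ n := by gcongr; exact hb x
      _ = _ := one_mul _
  refine ⟨∑' n, v n, tsum_mem hA hvm, fun x => ?_⟩
  have h1 : ‖u x‖ < 1 := (hb x).trans_lt (by norm_num)
  have h2 := (ContinuousMap.evalCLM (M := ℂ) ℂ x).hasSum hs.hasSum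
  have h3 := Complex.hasSum_taylorSeries_log h1
  have h4 : (∑' n, v n) x = log (1 + u x) := by
    refine HasSum.unique h2 ?_
    convert h3 using 1
    funext n
    simp [hv]; ring
  rw [h4, Complex.exp_log]
  intro h0
  have : u x = -1 := by linear_combination h0
  rw [this] at h1; simp at h1

theorem continuousMap_log_step {X : Type*} [TopologicalSpace X] [CompactSpace X]
    {A : Subalgebra ℂ C(X, ℂ)} (hA : IsClosed (A : Set C(X, ℂ))) {h g : C(X, ℂ)} (hh : h ∈ A)
    (hg : g ∈ A) (hb : ∀ x, ‖g x - exp (h x)‖ ≤ 1 / 2 * ‖exp (h x)‖) :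
    ∃ l ∈ A, ∀ x, exp (l x) = g x := by
  obtain ⟨e, he, he'⟩ := continuousMap_exp_mem hA (A.neg_mem hh)
  obtain ⟨l, hl, hl'⟩ := continuousMap_log_mem (u := g * e - 1) hA
    (A.sub_mem (A.mul_mem hg he) A.one_mem) (fun x => by
      have h1 : (g * e - 1) x = (g x - exp (h x)) * exp (-h x) := by
        simp only [ContinuousMap.sub_apply, ContinuousMap.mul_apply, he', ContinuousMap.one_apply,
          ContinuousMap.neg_apply, sub_mul, ← Complex.exp_add]
        simp
      rw [h1, norm_mul]
      calc _ ≤ (1 / 2 * ‖exp (h x)‖) * ‖exp (-h x)‖ := by gcongr; exact hb x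
        _ = 1 / 2 := by rw [mul_assoc, ← norm_mul, ← Complex.exp_add]; simp)
  refine ⟨h + l, A.add_mem hh hl, fun x => ?_⟩
  simp only [ContinuousMap.add_apply, Complex.exp_add, hl', ContinuousMap.sub_apply,
    ContinuousMap.mul_apply, he', ContinuousMap.neg_apply, ContinuousMap.one_apply, add_sub_cancel]
  rw [mul_left_comm, ← Complex.exp_add]; simp

/-- A logarithm on a spiral region can be approximated by polynomials. -/
theorem exists_polynomial_near_log {k : ℂ} (hk : 0 < k.re) {S : Set ℂ} (hS : IsCompact S)
    (hconn : IsPreconnected S) (hne : S.Nonempty)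
    (him : ∀ x ∈ S, |x.im| < Real.pi * k.re / ‖k‖ ^ 2) {η : ℝ} (hη : 0 < η) :
    ∃ p : Polynomial ℂ, ∀ x ∈ S, ‖p.eval (exp (k * x)) - k * x‖ < η := by
  have : CompactSpace S := isCompact_iff_compactSpace.1 hS
  have : Nonempty S := hne.to_subtype
  have : PreconnectedSpace S := isPreconnected_iff_preconnectedSpace.1 hconn
  set y : C(S, ℂ) := ⟨fun x => exp (k * x), by fun_prop⟩ with hy
  set A := (Algebra.adjoin ℂ {y}).topologicalClosure with hAdef
  have hA : IsClosed (A : Set C(S, ℂ)) := Subalgebra.isClosed_topologicalClosure _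
  have hyA : y ∈ A := Subalgebra.le_topologicalClosure _ (Algebra.self_mem_adjoin_singleton _ _)
  have hcA : ∀ c : ℂ, algebraMap ℂ C(S, ℂ) c ∈ A := fun c => A.algebraMap_mem c
  have hnz : ∀ (t : ℝ) (x : S), exp (k * x) + exp (k * t) ≠ 0 := by
    intro t x h0
    have h1 : exp (k * (x - t)) = exp (Real.pi * I) := by
      rw [mul_sub, Complex.exp_sub, Complex.exp_pi_mul_I, div_eq_iff (Complex.exp_ne_zero _)]
      linear_combination h0
    obtain ⟨n, hn⟩ := Complex.exp_eq_exp_iff_exists_int.1 h1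
    have hk0 : k ≠ 0 := by rintro rfl; simp at hk
    have h2 : (x : ℂ) = t + (Real.pi * (2 * n + 1)) * I / k := by
      field_simp; linear_combination hn
    have h3 : (x : ℂ).im = Real.pi * (2 * n + 1) * k.re / ‖k‖ ^ 2 := by
      rw [h2, Complex.add_im, Complex.ofReal_im, Complex.div_im, ← Complex.normSq_eq_norm_sq]
      simp
    have h4 := him x x.2
    rw [h3, abs_div, abs_mul, abs_mul, abs_of_pos Real.pi_pos, abs_of_pos hk,
      abs_of_nonneg (by positivity : (0:ℝ) ≤ ‖k‖ ^ 2)] at h4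
    have h5 : 0 < ‖k‖ ^ 2 := by positivity
    rw [div_lt_div_iff_of_pos_right h5] at h4
    have h6 : |(2 * (n : ℝ) + 1)| < 1 := by
      by_contra! h
      have : 0 < Real.pi * k.re := by positivity
      nlinarith
    have h7 : |2 * n + 1| < 1 := by exact_mod_cast h6
    have := abs_lt.1 h7
    omega
  set g : ℝ → C(S, ℂ) := fun t => y + algebraMap ℂ C(S, ℂ) (exp (k * t)) with hg
  have hgA : ∀ t, g t ∈ A := fun t => A.add_mem hyA (hcA _)
  have hgx : ∀ t x, g t x = exp (k * x) + exp (k * t) := fun t x => by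
    simp [hg, hy]
  have hlow : ∀ G : C(S, ℂ), (∀ x, G x ≠ 0) → ∃ m > 0, ∀ x, m ≤ ‖G x‖ := by
    intro G hG
    obtain ⟨x, -, hx⟩ := isCompact_univ.exists_isMinOn (univ_nonempty (α := S))
      (f := fun x => ‖G x‖) (by fun_prop)
    exact ⟨‖G x‖, norm_pos_iff.2 (hG x), fun z => hx (mem_univ z)⟩
  set Q : Set ℝ := {t | ∃ l ∈ A, ∀ x, exp (l x) = g t x} with hQ
  have hloc : ∀ t0 : ℝ, ∀ᶠ t in nhds t0, (t ∈ Q ↔ t0 ∈ Q) := by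
    intro t0
    obtain ⟨m, hm, hm'⟩ := hlow (g t0) (fun x => by rw [hgx]; exact hnz t0 x)
    have hcont : Tendsto (fun t : ℝ => ‖exp (k * t) - exp (k * t0)‖) (nhds t0) (nhds 0) := by
      have : Continuous (fun t : ℝ => ‖exp (k * t) - exp (k * t0)‖) := by fun_prop
      simpa using this.tendsto t0
    filter_upwards [hcont.eventually (gt_mem_nhds (show 0 < m / 4 by positivity))] with t ht
    have e1 : ∀ x, g t x - g t0 x = exp (k * t) - exp (k * t0) := fun x => by
      rw [hgx, hgx]; ring
    constructor
    · rintro ⟨l, hl, hl'⟩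
      refine continuousMap_log_step hA hl (hgA t0) fun x => ?_
      rw [hl', norm_sub_rev, e1]
      have := norm_sub_norm_le (g t0 x) (g t x)
      rw [norm_sub_rev, e1] at this
      linarith [hm' x]
    · rintro ⟨l, hl, hl'⟩
      refine continuousMap_log_step hA hl (hgA t) fun x => ?_
      rw [hl', e1]
      linarith [hm' x]
  have hclopen : IsClopen Q := by
    refine ⟨isOpen_compl_iff.1 ?_, ?_⟩
    · rw [isOpen_iff_mem_nhds]
      intro t ht
      filter_upwards [hloc t] with s hs
      exact fun h => ht (hs.1 h)
    · rw [isOpen_iff_mem_nhds]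
      intro t ht
      filter_upwards [hloc t] with s hs
      exact hs.2 ht
  have hexpn : ∀ t : ℝ, ‖exp (k * t)‖ = Real.exp (k.re * t) := fun t => by
    rw [Complex.norm_exp]; simp
  have hQne : Q.Nonempty := by
    have ht : Tendsto (fun t : ℝ => Real.exp (k.re * t)) atTop atTop :=
      Real.tendsto_exp_atTop.comp (tendsto_id.const_mul_atTop hk)
    obtain ⟨t, ht⟩ := (ht.eventually_ge_atTop (2 * ‖y‖)).exists
    refine ⟨t, continuousMap_log_step hA (hcA (k * t)) (hgA t) fun x => ?_⟩
    have : ‖y x‖ ≤ ‖y‖ := y.norm_coe_le_norm x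
    have e : (algebraMap ℂ C(S, ℂ) (k * t)) x = k * t := by simp
    rw [e, hgx, add_sub_cancel_right, hexpn]
    change ‖exp (k * x)‖ ≤ ‖y‖ at this
    linarith
  have hQu : Q = univ := hclopen.eq_univ hQne
  have hyl : ∃ l ∈ A, ∀ x, exp (l x) = y x := by
    obtain ⟨m, hm, hm'⟩ := hlow y (fun x => Complex.exp_ne_zero _)
    have ht : Tendsto (fun t : ℝ => Real.exp (k.re * t)) atBot (nhds 0) :=
      Real.tendsto_exp_atBot.comp (tendsto_id.const_mul_atBot hk)
    obtain ⟨t, ht⟩ := (ht.eventually (gt_mem_nhds (show 0 < m / 3 by positivity))).exists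
    obtain ⟨l, hl, hl'⟩ : t ∈ Q := hQu ▸ mem_univ t
    refine continuousMap_log_step hA hl hyA fun x => ?_
    have e : y x - g t x = - exp (k * t) := by rw [hgx]; simp [hy]
    rw [hl', e, norm_neg, hexpn]
    have h1 : ‖y x‖ - ‖exp (k * t)‖ ≤ ‖g t x‖ := by
      have := norm_sub_le (g t x) (exp (k * t))
      rw [hgx, add_sub_cancel_right] at this
      rw [hgx]
      change ‖exp (k * x)‖ - _ ≤ _
      linarith
    rw [hexpn] at h1
    linarith [hm' x]
  obtain ⟨l, hl, hl'⟩ := hyl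
  obtain ⟨x0⟩ := ‹Nonempty S›
  set w : C(S, ℂ) := l - algebraMap ℂ C(S, ℂ) (l x0 - k * x0) with hw
  have hwA : w ∈ A := A.sub_mem hl (hcA _)
  have hwx : ∀ x : S, w x = k * x := by
    intro x
    have := exp_fiber_constant (isPreconnected_univ (α := S)) (h := fun x => l x - k * x) (c := 1)
      (by fun_prop) (fun x _ => by
        rw [Complex.exp_sub, hl']; exact div_self (Complex.exp_ne_zero _)) (mem_univ x) (mem_univ x0)
    simp [hw]
    linear_combination this
  have hwc : w ∈ closure ((Algebra.adjoin ℂ {y} : Subalgebra ℂ C(S, ℂ)) : Set C(S, ℂ)) := by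
    rw [← Subalgebra.topologicalClosure_coe]; exact hwA
  obtain ⟨b, hb, hb'⟩ := Metric.mem_closure_iff.1 hwc η hη
  rw [SetLike.mem_coe, Algebra.adjoin_singleton_eq_range_aeval] at hb
  obtain ⟨p, rfl⟩ := hb
  refine ⟨p, fun x hx => ?_⟩
  have h1 := (ContinuousMap.norm_coe_le_norm (w - Polynomial.aeval y p) ⟨x, hx⟩)
  rw [← dist_eq_norm] at h1
  have h2 := h1.trans_lt hb'
  have h3 : (Polynomial.aeval y p) ⟨x, hx⟩ = p.eval (exp (k * x)) := by
    rw [Polynomial.aeval_continuousMap_apply]; rfl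
  rw [ContinuousMap.sub_apply, hwx, norm_sub_rev, h3] at h2
  exact h2

theorem exists_preimage_of_near_id {G : ℂ → ℂ} {y : ℂ} {κ : ℝ} (hκ : 0 ≤ κ) {c : NNReal}
    (hL : ∀ x ∈ closedBall y κ, ∀ x' ∈ closedBall y κ, ‖(G x - x) - (G x' - x')‖ ≤ c * ‖x - x'‖)
    (hy : ‖G y - y‖ ≤ (1 - c) * κ) : ∃ x ∈ closedBall y κ, G x = y := by
  have h1 : ApproximatesLinearOn G ((ContinuousLinearEquiv.refl ℂ ℂ : ℂ ≃L[ℂ] ℂ) : ℂ →L[ℂ] ℂ)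
      (closedBall y κ) c := by
    intro x hx x' hx'
    have h := hL x hx x' hx'
    rw [sub_sub_sub_comm] at h
    simpa using h
  have h2 := h1.surjOn_closedBall_of_nonlinearRightInverse
    (ContinuousLinearEquiv.refl ℂ ℂ).toNonlinearRightInverse hκ Subset.rfl
  refine h2 ?_
  have : ((ContinuousLinearEquiv.refl ℂ ℂ).toNonlinearRightInverse.nnnorm : ℝ) = 1 := by
    simp [ContinuousLinearEquiv.toNonlinearRightInverse]
  rw [this, mem_closedBall, dist_comm, dist_eq_norm]
  simpa using hy

/-- The logarithmic straightening of an annular spiral by an entire map without critical points. -/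
theorem exists_straightening {k ζ : ℂ} (hk : 0 < k.re) (hζ : ζ ≠ 0) {κ : ℝ} (hκ : 0 < κ)
    (hκ1 : 3 * κ ≤ 1) (hκ2 : 3 * κ < Real.pi * k.re / ‖k‖ ^ 2) {η : ℝ} (hη : 0 < η) (hηκ : η ≤ κ) :
    ∃ Q X : ℂ → ℂ, Differentiable ℂ Q ∧ (∀ w, deriv Q w ≠ 0) ∧ Q 0 = 0 ∧ X 0 = 0 ∧
      ∀ y ∈ Ioo (-κ) (1 + κ) ×ℂ Ioo (-κ) κ, ‖X y - y‖ ≤ η ∧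
        Q (ζ * (exp (k * X y) - 1)) = y ∧ DifferentiableAt ℂ X y := by
  set S : Set ℂ := Icc (-(3 * κ)) (1 + 3 * κ) ×ℂ Icc (-(3 * κ)) (3 * κ) with hS
  have hSc : IsCompact S := isCompact_Icc.reProdIm isCompact_Icc
  have hSconv : Convex ℝ S := by
    have h1 : Convex ℝ (Complex.reLm ⁻¹' Icc (-(3 * κ)) (1 + 3 * κ)) :=
      (convex_Icc _ _).linear_preimage _
    have h2 : Convex ℝ (Complex.imLm ⁻¹' Icc (-(3 * κ)) (3 * κ)) :=
      (convex_Icc _ _).linear_preimage _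
    exact h1.inter h2
  have h0S : (0 : ℂ) ∈ S := by
    refine ⟨⟨?_, ?_⟩, ?_, ?_⟩ <;> simp <;> linarith
  have hk0 : k ≠ 0 := by rintro rfl; simp at hk
  have hη8 : 0 < η / 16 := by positivity
  obtain ⟨p, hp⟩ := exists_polynomial_near_log hk hSc hSconv.isPreconnected ⟨0, h0S⟩
    (fun x hx => (abs_le.2 hx.2).trans_lt hκ2) hη8
  obtain ⟨Q0, hQ0⟩ := Differentiable.isExactOn_univ
    (f := fun w => 1 / (ζ * k) * exp (-p.eval (1 + w / ζ))) (by
      have := p.differentiable (𝕜 := ℂ)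
      have h2 : Differentiable ℂ (fun w : ℂ => p.eval (1 + w / ζ)) :=
        this.comp (by fun_prop : Differentiable ℂ (fun w : ℂ => 1 + w / ζ))
      fun_prop)
  set Q : ℂ → ℂ := fun w => Q0 w - Q0 0 with hQdef
  have hQ : ∀ w, HasDerivAt Q (1 / (ζ * k) * exp (-p.eval (1 + w / ζ))) w := fun w =>
    (hQ0 w (mem_univ _)).sub_const _
  set G : ℂ → ℂ := fun x => Q (ζ * (exp (k * x) - 1)) with hG
  have hGd : ∀ x, HasDerivAt G (exp (k * x - p.eval (exp (k * x)))) x := by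
    intro x
    have h1 : HasDerivAt (fun x => ζ * (exp (k * x) - 1)) (ζ * (exp (k * x) * (k * 1))) x :=
      ((((hasDerivAt_id x).const_mul k).cexp).sub_const 1).const_mul ζ
    convert! (hQ (ζ * (exp (k * x) - 1))).comp x h1 using 1
    rw [Complex.exp_sub, mul_div_cancel_left₀ _ hζ, add_sub_cancel, Complex.exp_neg]
    field_simp
  have hG0 : G 0 = 0 := by simp [hG, hQdef]
  have hGd1 : ∀ x ∈ S, ‖exp (k * x - p.eval (exp (k * x))) - 1‖ ≤ η / 8 := by
    intro x hx
    have h1 := hp x hx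
    rw [norm_sub_rev] at h1
    have := Complex.norm_exp_sub_one_le (x := k * x - p.eval (exp (k * x))) (by linarith)
    linarith
  have hLip : ∀ x ∈ S, ∀ x' ∈ S, ‖(G x - x) - (G x' - x')‖ ≤ η / 8 * ‖x - x'‖ := by
    intro x hx x' hx'
    exact hSconv.norm_image_sub_le_of_norm_hasDerivWithin_le (f := fun x => G x - x)
      (fun z _ => ((hGd z).sub (hasDerivAt_id z)).hasDerivWithinAt) hGd1 hx' hx
  have hV : ∀ y ∈ Ioo (-κ) (1 + κ) ×ℂ Ioo (-κ) κ, closedBall y κ ⊆ S := by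
    rintro y ⟨⟨h1, h2⟩, h3, h4⟩ x hx
    rw [mem_closedBall, dist_eq_norm] at hx
    have h5 := abs_le.1 ((Complex.abs_re_le_norm _).trans hx)
    have h6 := abs_le.1 ((Complex.abs_im_le_norm _).trans hx)
    rw [Complex.sub_re] at h5
    rw [Complex.sub_im] at h6
    refine ⟨⟨?_, ?_⟩, ?_, ?_⟩ <;> linarith [h5.1, h5.2, h6.1, h6.2]
  have hSn : ∀ x ∈ S, ‖x‖ ≤ 3 := by
    rintro x ⟨⟨h1, h2⟩, h3⟩
    have := Complex.norm_le_abs_re_add_abs_im x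
    have h4 : |x.re| ≤ 2 := abs_le.2 ⟨by linarith, by linarith⟩
    have h5 : |x.im| ≤ 1 := (abs_le.2 h3).trans hκ1
    linarith
  have hclose : ∀ x ∈ S, ‖G x - x‖ ≤ η / 2 := by
    intro x hx
    have h1 := hLip x hx 0 h0S
    rw [hG0, sub_zero, sub_zero, sub_zero] at h1
    nlinarith [hSn x hx]
  have hex : ∀ y : ℂ, ∃ x, y ∈ Ioo (-κ) (1 + κ) ×ℂ Ioo (-κ) κ → x ∈ S ∧ G x = y := by
    intro y
    by_cases hy : y ∈ Ioo (-κ) (1 + κ) ×ℂ Ioo (-κ) κ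
    · have hyS : y ∈ S := hV y hy (mem_closedBall_self hκ.le)
      obtain ⟨x, hx, hx'⟩ := exists_preimage_of_near_id (G := G) (y := y) hκ.le (c := 1 / 2) (by
        intro x hx x' hx'
        refine (hLip x (hV y hy hx) x' (hV y hy hx')).trans ?_
        gcongr
        rw [NNReal.coe_div]; norm_num; linarith) (by
        refine (hclose y hyS).trans ?_
        rw [NNReal.coe_div]; norm_num; linarith)
      exact ⟨x, fun _ => ⟨hV y hy hx, hx'⟩⟩
    · exact ⟨0, fun h => absurd h hy⟩
  choose X hX using hex
  have hinj : ∀ x ∈ S, ∀ x' ∈ S, ‖x - x'‖ ≤ 2 * ‖G x - G x'‖ := by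
    intro x hx x' hx'
    have h1 := hLip x hx x' hx'
    have h2 := norm_sub_le (G x - G x') ((G x - x) - (G x' - x'))
    have h3 : G x - G x' - ((G x - x) - (G x' - x')) = x - x' := by ring
    rw [h3] at h2
    nlinarith [norm_nonneg (x - x')]
  have hopen : IsOpen (Ioo (-κ) (1 + κ) ×ℂ Ioo (-κ) κ) := isOpen_Ioo.reProdIm isOpen_Ioo
  have h0V : (0 : ℂ) ∈ Ioo (-κ) (1 + κ) ×ℂ Ioo (-κ) κ := by
    simp [mem_reProdIm, hκ]; linarith
  refine ⟨Q, X, fun w => (hQ w).differentiableAt, fun w => ?_, by simp [hQdef], ?_, ?_⟩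
  · rw [(hQ w).deriv]
    simp [hζ, hk0, Complex.exp_ne_zero]
  · have := hinj (X 0) (hX 0 h0V).1 0 h0S
    rw [(hX 0 h0V).2, hG0] at this
    simpa using this
  · intro y hy
    obtain ⟨h1, h2⟩ := hX y hy
    refine ⟨?_, h2, ?_⟩
    · have := hclose _ h1
      rw [h2, norm_sub_rev] at this
      linarith
    · have hcont : ContinuousAt X y := by
        rw [Metric.continuousAt_iff']
        intro e he
        filter_upwards [hopen.mem_nhds hy, ball_mem_nhds y (half_pos he)] with z hz hz'
        have := hinj _ (hX z hz).1 _ h1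
        rw [(hX z hz).2, h2] at this
        rw [mem_ball, dist_eq_norm] at hz'
        rw [dist_eq_norm]
        linarith
      refine (HasDerivAt.of_local_left_inverse hcont (hGd (X y)) (Complex.exp_ne_zero _)
        ?_).differentiableAt
      filter_upwards [hopen.mem_nhds hy] with z hz using (hX z hz).2

/-- The conformal parametrization of a thin finger around `[0, 1]`. -/
theorem exists_finger {κ : ℝ} (hκ : 0 < κ) :
    ∃ (F ψ : ℂ → ℂ) (R : ℝ), 1 < R ∧ Differentiable ℂ F ∧ (∀ x, deriv F x ≠ 0) ∧ F 0 = 0 ∧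
      ψ 0 = 0 ∧ ψ 1 = 1 ∧ ‖ψ (-1)‖ ≤ κ ∧ DifferentiableOn ℂ ψ (ball 0 R) ∧
      ∀ u ∈ ball (0 : ℂ) R, ψ u ∈ Ioo (-κ) (1 + κ) ×ℂ Ioo (-κ) κ ∧ F (ψ u) = u := by
  set a : ℝ := 2 / κ + 1 with ha
  have ha0 : 0 < a := by positivity
  have haκ : 2 < a * κ := by rw [ha, add_mul, div_mul_cancel₀ _ hκ.ne']; linarith
  set b : ℝ := Real.exp (-a) with hb
  have hb0 : 0 < b := Real.exp_pos _
  have hb1 : b < 1 := by rw [hb, Real.exp_lt_one_iff]; linarith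
  set ρ : ℝ := 1 - b with hρ
  have hρ0 : 0 < ρ := by linarith
  have hρC : (ρ : ℂ) ≠ 0 := by exact_mod_cast hρ0.ne'
  have haC : (a : ℂ) ≠ 0 := by exact_mod_cast ha0.ne'
  set R : ℝ := (1 - b / 2) / ρ with hR
  have hlog2 : Real.log 2 < 1 := by linarith [Real.log_two_lt_d9]
  have hu : ∀ u ∈ ball (0 : ℂ) R, ‖(ρ : ℂ) * u‖ < 1 - b / 2 := by
    intro u hu
    rw [mem_ball_zero_iff, hR, lt_div_iff₀ hρ0] at hu
    rw [norm_mul, Complex.norm_real, Real.norm_of_nonneg hρ0.le]; linarith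
  have hre : ∀ u ∈ ball (0 : ℂ) R, 0 < (1 - (ρ : ℂ) * u).re := by
    intro u h
    have h1 := hu u h
    have h2 := Complex.re_le_norm ((ρ : ℂ) * u)
    rw [Complex.sub_re, Complex.one_re]; linarith
  have hne : ∀ u ∈ ball (0 : ℂ) R, (1 - (ρ : ℂ) * u) ≠ 0 := by
    intro u h h0
    have := hre u h
    rw [h0] at this; simp at this
  refine ⟨fun x => (1 - exp (-a * x)) / ρ, fun u => -log (1 - ρ * u) / a, R, ?_, by fun_prop,
    ?_, by simp, by simp, ?_, ?_, ?_, ?_⟩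
  · rw [hR, one_lt_div hρ0]; linarith
  · intro x
    have h1 : HasDerivAt (fun x : ℂ => (1 - exp (-a * x)) / ρ)
        (-(exp (-a * x) * (-a * 1)) / ρ) x :=
      ((((hasDerivAt_id x).const_mul (-a : ℂ)).cexp).const_sub 1).div_const _
    rw [h1.deriv]
    simp [hρC, haC, Complex.exp_ne_zero]
  · have : (1 - (ρ : ℂ) * 1) = ((b : ℝ) : ℂ) := by rw [hρ]; push_cast; ring
    simp only [this]
    rw [← Complex.ofReal_log hb0.le, hb, Real.log_exp]
    push_cast
    field_simp
  · have : (1 - (ρ : ℂ) * -1) = ((1 + ρ : ℝ) : ℂ) := by push_cast; ring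
    simp only [this]
    rw [← Complex.ofReal_log (by linarith), norm_div, norm_neg, Complex.norm_real,
      Complex.norm_real, Real.norm_of_nonneg ha0.le, Real.norm_of_nonneg (Real.log_nonneg (by linarith)),
      div_le_iff₀ ha0]
    have := Real.log_le_log (by linarith : 0 < 1 + ρ) (by linarith : 1 + ρ ≤ 2)
    nlinarith
  · intro u h
    have h1 : (1 - (ρ : ℂ) * u) ∈ slitPlane := Or.inl (hre u h)
    have h2 : DifferentiableAt ℂ (fun u : ℂ => 1 - (ρ : ℂ) * u) u := by fun_prop
    exact ((h2.clog h1).neg.div_const _).differentiableWithinAt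
  · intro u h
    have hz := hu u h
    have hzre := hre u h
    refine ⟨?_, ?_⟩
    · set z : ℂ := 1 - (ρ : ℂ) * u with hzdef
      have n1 : b / 2 < ‖z‖ := by
        have := norm_sub_norm_le (1 : ℂ) ((ρ : ℂ) * u)
        rw [norm_one] at this; linarith
      have n2 : ‖z‖ < 2 := by
        have := norm_sub_le (1 : ℂ) ((ρ : ℂ) * u)
        rw [norm_one] at this; linarith
      have l1 : -a - Real.log 2 ≤ Real.log ‖z‖ := by
        have := Real.log_le_log (by positivity) n1.le
        rwa [Real.log_div hb0.ne' two_ne_zero, hb, Real.log_exp] at this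
      have l2 : Real.log ‖z‖ ≤ Real.log 2 := Real.log_le_log (by linarith) n2.le
      have e1 : (-log z / (a : ℂ)).re = -Real.log ‖z‖ / a := by
        rw [Complex.div_ofReal_re, Complex.neg_re, Complex.log_re]
      have e2 : (-log z / (a : ℂ)).im = -arg z / a := by
        rw [Complex.div_ofReal_im, Complex.neg_im, Complex.log_im]
      have h3 := abs_le.1 (Complex.abs_arg_le_pi_div_two_iff.2 hzre.le)
      have h4 := Real.pi_lt_four
      have h5 := h3.1
      have h6 := h3.2
      rw [mem_reProdIm, e1, e2]
      refine ⟨⟨?_, ?_⟩, ?_, ?_⟩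
      · rw [lt_div_iff₀ ha0]; nlinarith
      · rw [div_lt_iff₀ ha0]; nlinarith
      · rw [lt_div_iff₀ ha0]; nlinarith
      · rw [div_lt_iff₀ ha0]; nlinarith
    · have : -(a : ℂ) * (-log (1 - ρ * u) / a) = log (1 - ρ * u) := by field_simp
      simp only [this]
      rw [Complex.exp_log (hne u h)]
      field_simp
      ring

set_option maxHeartbeats 1000000 in
/-- A conformal map from a disk onto a thin spiral strip inside the unit disk, whose inverse
extends to an entire map without critical points. -/
theorem exists_spiral_map {r₁ r₂ ε Λ : ℝ} (hr₂ : 0 < r₂) (hr : r₂ < r₁)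
    (hε : 0 < ε) :
    ∃ (T Ψ ℓ : ℂ → ℂ) (R : ℝ), 1 < R ∧ Differentiable ℂ T ∧ (∀ x, deriv T x ≠ 0) ∧ T 0 = 0 ∧
      Ψ 0 = 0 ∧ DifferentiableOn ℂ Ψ (ball 0 R) ∧ (∀ u ∈ ball (0 : ℂ) R, ‖Ψ u‖ < 1) ∧
      (∀ u ∈ ball (0 : ℂ) R, T (Ψ u) = u) ∧ ‖Ψ 1 - 1‖ < ε ∧ ‖Ψ (-1)‖ < ε ∧
      ContinuousOn ℓ {u ∈ ball 0 R | r₂ ≤ ‖Ψ u‖} ∧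
      (∀ u ∈ ball (0 : ℂ) R, r₂ ≤ ‖Ψ u‖ → exp (ℓ u) = Ψ u) ∧
      ∀ u ∈ ball (0 : ℂ) R, ∀ u' ∈ ball (0 : ℂ) R, ‖Ψ u‖ = r₂ → r₁ ≤ ‖Ψ u'‖ →
        Λ ≤ (ℓ u').im - (ℓ u).im := by
  obtain ⟨δ, hδ0, hδ1, hδε⟩ : ∃ δ : ℝ, 0 < δ ∧ δ < 1 ∧ δ < ε / 2 :=
    ⟨min (1 / 2) (ε / 4), by positivity, (min_le_left _ _).trans_lt (by norm_num),
      (min_le_right _ _).trans_lt (by linarith)⟩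
  set μ : ℝ := 1 - δ with hμ
  have hμ0 : 0 < μ := by linarith
  set D : ℝ := (Real.log r₁ - Real.log r₂) / 2 with hD
  have hD0 : 0 < D := by have := Real.log_lt_log hr₂ hr; rw [hD]; linarith
  -- choice of the modulus parameter
  have hζt : Tendsto (fun A : ℝ => μ / (Real.exp A - 1)) atTop (nhds 0) :=
    Tendsto.const_div_atTop (tendsto_atTop_add_const_right _ (-1) Real.tendsto_exp_atTop) _
  have hlogt : Tendsto (fun z : ℝ => Real.log (r₁ - z) - Real.log (r₂ + z)) (nhds 0)
      (nhds (Real.log r₁ - Real.log r₂)) := by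
    have h1 : ContinuousAt (fun z : ℝ => Real.log (r₁ - z) - Real.log (r₂ + z)) 0 := by
      refine ContinuousAt.sub (ContinuousAt.log (by fun_prop) (by simp; linarith))
        (ContinuousAt.log (by fun_prop) (by simp; linarith))
    simpa [ContinuousAt] using h1
  obtain ⟨A, hA1, hA2, hA3, hA4⟩ : ∃ A : ℝ, 0 < A ∧ 4 / δ + 2 < Real.exp A ∧
      μ / (Real.exp A - 1) < r₂ / 2 ∧
      D < Real.log (r₁ - μ / (Real.exp A - 1)) - Real.log (r₂ + μ / (Real.exp A - 1)) := by
    have h1 := eventually_gt_atTop (0 : ℝ)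
    have h2 := Real.tendsto_exp_atTop.eventually_gt_atTop (4 / δ + 2)
    have h3 := hζt.eventually (gt_mem_nhds (half_pos hr₂))
    have h4 := (hlogt.comp hζt).eventually (lt_mem_nhds (show D < _ by rw [hD] at hD0 ⊢; linarith))
    exact (h1.and (h2.and (h3.and h4))).exists
  set E := Real.exp A with hE
  have hδ4 : 0 < 4 / δ := by positivity
  have hE2 : 2 < E := by linarith
  set ζ : ℝ := μ / (E - 1) with hζ
  have hζ0 : 0 < ζ := div_pos hμ0 (by linarith)
  have hζE : ζ * (E - 1) = μ := by rw [hζ]; field_simp [show E - 1 ≠ 0 by linarith]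
  -- choice of the number of turns
  obtain ⟨N, hN⟩ := exists_nat_ge ((Λ + 2 * Real.pi + D / 2) * A / (Real.pi * D))
  have hpi := Real.pi_pos
  rw [div_le_iff₀ (by positivity)] at hN
  set k : ℂ := A + (2 * Real.pi * N : ℝ) * I with hk
  have hkre : k.re = A := by simp [hk]
  have hkim : k.im = 2 * Real.pi * N := by simp [hk]
  have hkA : A ≤ ‖k‖ := by have := Complex.re_le_norm k; rwa [hkre] at this
  have hkN : 2 * Real.pi * N ≤ ‖k‖ := by
    have := (le_abs_self _).trans (Complex.abs_im_le_norm k); rwa [hkim] at this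
  have hk0 : 0 < ‖k‖ := by linarith
  have hexpk : exp k = E := by
    have : k = (A : ℝ) + (N : ℤ) * (2 * Real.pi * I) := by rw [hk]; push_cast; ring
    rw [this, Complex.exp_add, Complex.exp_int_mul_two_pi_mul_I, mul_one, hE, Complex.ofReal_exp]
  -- choice of the width
  obtain ⟨κ, hκ0, hκ1, hκ2, hκ3, hκ4, hκ5⟩ : ∃ κ : ℝ, 0 < κ ∧ 3 * κ < 1 ∧
      3 * κ < Real.pi * k.re / ‖k‖ ^ 2 ∧ 16 * ‖k‖ * κ < δ ∧ 8 * ‖k‖ * κ < D ∧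
      16 * ‖k‖ * κ < ε := by
    have ev : ∀ c d : ℝ, 0 < d → ∀ᶠ κ in nhdsWithin (0 : ℝ) (Ioi 0), c * κ < d := by
      intro c d hd
      have : Tendsto (fun κ : ℝ => c * κ) (nhds 0) (nhds 0) := by
        simpa using (continuous_const_mul c).tendsto (0 : ℝ)
      exact (this.eventually (gt_mem_nhds hd)).filter_mono nhdsWithin_le_nhds
    have h0 : ∀ᶠ κ in nhdsWithin (0 : ℝ) (Ioi 0), 0 < κ := eventually_mem_nhdsWithin
    exact (h0.and ((ev 3 1 one_pos).and ((ev 3 _ (by rw [hkre]; positivity)).and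
      ((ev (16 * ‖k‖) δ hδ0).and ((ev (8 * ‖k‖) D hD0).and (ev (16 * ‖k‖) ε hε)))))).exists
  obtain ⟨Q, X, hQd, hQ', hQ0, hX0, hX⟩ := exists_straightening (k := k) (ζ := ζ)
    (by rw [hkre]; exact hA1) (by exact_mod_cast hζ0.ne') hκ0 hκ1.le hκ2 hκ0 le_rfl
  obtain ⟨F, ψ, R, hR, hF, hF', hF0, hψ0, hψ1, hψm1, hψd, hψ⟩ := exists_finger hκ0
  set x : ℂ → ℂ := fun u => X (ψ u) with hx
  set Ψ : ℂ → ℂ := fun u => ζ * (exp (k * x u) - 1) with hΨ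
  have hxd : DifferentiableOn ℂ x (ball 0 R) := by
    intro u hu
    exact ((hX _ (hψ u hu).1).2.2.comp u ((hψd u hu).differentiableAt
      (isOpen_ball.mem_nhds hu))).differentiableWithinAt
  have hxn : ∀ u ∈ ball (0 : ℂ) R, ‖x u - ψ u‖ ≤ κ := fun u hu => (hX _ (hψ u hu).1).1
  have hxim : ∀ u ∈ ball (0 : ℂ) R, |(x u).im| ≤ 2 * κ := by
    intro u hu
    have h1 := (Complex.abs_im_le_norm _).trans (hxn u hu)
    have h2 := (hψ u hu).1.2
    rw [Complex.sub_im] at h1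
    have h3 := abs_le.1 h1
    exact abs_le.2 ⟨by linarith [h2.1, h3.1], by linarith [h2.2, h3.2]⟩
  have hxre : ∀ u ∈ ball (0 : ℂ) R, (x u).re ≤ 1 + 2 * κ := by
    intro u hu
    have h1 := (Complex.abs_re_le_norm _).trans (hxn u hu)
    have h2 := (hψ u hu).1.1
    rw [Complex.sub_re] at h1
    linarith [h2.2, (abs_le.1 h1).2]
  have hkx : ∀ u, (k * x u).re = A * (x u).re - 2 * Real.pi * N * (x u).im := fun u => by
    rw [Complex.mul_re, hkre, hkim]
  have hkxi : ∀ u, (k * x u).im = A * (x u).im + 2 * Real.pi * N * (x u).re := fun u => by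
    rw [Complex.mul_im, hkre, hkim]
  have hΨn : ∀ u, ‖Ψ u‖ = ζ * ‖exp (k * x u) - 1‖ := fun u => by
    simp only [hΨ]
    rw [norm_mul, Complex.norm_real, Real.norm_of_nonneg hζ0.le]
  have h1R : (1 : ℂ) ∈ ball (0 : ℂ) R := by simpa using hR
  have hm1R : (-1 : ℂ) ∈ ball (0 : ℂ) R := by simpa using hR
  have hNn : (0 : ℝ) ≤ 2 * Real.pi * N := by positivity
  have hkκ : 0 < ‖k‖ * κ := by positivity
  have hbig : ∀ u, r₂ ≤ ‖Ψ u‖ → r₂ / ζ - 1 ≤ Real.exp (k * x u).re := by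
    intro u hu
    rw [hΨn] at hu
    have h2 := norm_sub_le (exp (k * x u)) 1
    rw [norm_one, Complex.norm_exp] at h2
    rw [sub_le_iff_le_add, div_le_iff₀ hζ0]
    linarith [mul_le_mul_of_nonneg_left h2 hζ0.le]
  have hre0 : ∀ u, r₂ ≤ ‖Ψ u‖ → 0 < (k * x u).re := by
    intro u hu
    have h1 := hbig u hu
    have h2 : 1 < Real.exp (k * x u).re := by
      refine lt_of_lt_of_le ?_ h1
      rw [lt_sub_iff_add_lt, lt_div_iff₀ hζ0]; linarith
    exact Real.one_lt_exp_iff.1 h2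
  have hslit : ∀ u, r₂ ≤ ‖Ψ u‖ → 0 < (1 - exp (-(k * x u))).re := by
    intro u hu
    have h1 := Complex.re_le_norm (exp (-(k * x u)))
    rw [Complex.norm_exp, Complex.neg_re] at h1
    have h2 : Real.exp (-(k * x u).re) < 1 := by
      rw [Real.exp_lt_one_iff]; linarith [hre0 u hu]
    rw [Complex.sub_re, Complex.one_re]; linarith
  refine ⟨fun z => F (Q z), Ψ, fun u => log ζ + k * x u + log (1 - exp (-(k * x u))), R, hR,
    hF.comp hQd, ?_, by simp [hQ0, hF0], by simp [hΨ, hx, hψ0, hX0], ?_, ?_, ?_, ?_, ?_, ?_, ?_, ?_⟩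
  · intro z
    have := ((hF (Q z)).hasDerivAt.comp z (hQd z).hasDerivAt).deriv
    rw [show (fun z => F (Q z)) = F ∘ Q from rfl, this]
    exact mul_ne_zero (hF' _) (hQ' _)
  · have h1 : DifferentiableOn ℂ (fun u => k * x u) (ball 0 R) := hxd.const_mul k
    exact ((h1.cexp).sub_const 1).const_mul _
  · intro u hu
    rw [hΨn]
    have h1 := norm_sub_le (exp (k * x u)) 1
    rw [norm_one, Complex.norm_exp] at h1
    have h2 : (k * x u).re ≤ A + 4 * ‖k‖ * κ := by
      rw [hkx]
      have := abs_le.1 (hxim u hu)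
      have a1 : A * (x u).re ≤ A * (1 + 2 * κ) := by gcongr; exact hxre u hu
      have a2 : -(2 * Real.pi * N * (x u).im) ≤ (2 * Real.pi * N) * (2 * κ) := by
        rw [← mul_neg]; gcongr; linarith [this.1]
      linarith [mul_le_mul_of_nonneg_right hkA hκ0.le, mul_le_mul_of_nonneg_right hkN hκ0.le]
    have h3 : Real.exp (k * x u).re ≤ E * (1 + δ / 2) := by
      refine (Real.exp_le_exp.2 h2).trans ?_
      rw [Real.exp_add]
      gcongr
      have h4 := Real.abs_exp_sub_one_le (x := 4 * ‖k‖ * κ)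
        (by rw [abs_of_nonneg (by positivity)]; linarith)
      rw [abs_of_nonneg (a := 4 * ‖k‖ * κ) (by positivity)] at h4
      linarith [(abs_le.1 h4).2]
    have h4 : ζ * ‖exp (k * x u) - 1‖ ≤ ζ * (E * (1 + δ / 2) + 1) := by gcongr; linarith
    refine h4.trans_lt ?_
    rw [hζ, div_mul_eq_mul_div, div_lt_one (by linarith)]
    have h5 : 4 < E * δ := by
      have : 4 / δ < E := by linarith
      rwa [div_lt_iff₀ hδ0] at this
    rw [hμ]
    have h6 : 0 < E * δ ^ 2 := by positivity
    have h7 : (1 - δ) * (E * (1 + δ / 2) + 1) = E - E * δ / 2 + 1 - δ - E * δ ^ 2 / 2 := by ring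
    rw [h7]; linarith
  · intro u hu
    simp only [hΨ, hx]
    rw [(hX _ (hψ u hu).1).2.1, (hψ u hu).2]
  · have h1 : Ψ 1 - 1 = ζ * E * (exp (k * (x 1 - 1)) - 1) - δ := by
      have e1 : exp (k * x 1) = E * exp (k * (x 1 - 1)) := by
        rw [← hexpk, ← Complex.exp_add]; congr 1; ring
      have e2 : (ζ : ℂ) * (E - 1) = 1 - δ := by
        have := hζE; rw [hμ] at this; exact_mod_cast this
      simp only [hΨ]
      rw [e1]
      linear_combination e2
    have h2 : ‖k * (x 1 - 1)‖ ≤ ‖k‖ * κ := by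
      rw [norm_mul]; gcongr
      have := hxn 1 h1R
      rwa [hψ1] at this
    have h3 := Complex.norm_exp_sub_one_le (x := k * (x 1 - 1)) (by linarith)
    rw [h1]
    have h4 : ζ * E ≤ 2 := by linarith [mul_le_mul_of_nonneg_left hE2.le hζ0.le]
    calc ‖ζ * E * (exp (k * (x 1 - 1)) - 1) - δ‖
        ≤ ‖ζ * E * (exp (k * (x 1 - 1)) - 1)‖ + ‖(δ : ℂ)‖ := norm_sub_le _ _
      _ = ζ * E * ‖exp (k * (x 1 - 1)) - 1‖ + δ := by
          rw [norm_mul, norm_mul, Complex.norm_real, Complex.norm_real, Complex.norm_real,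
            Real.norm_of_nonneg hζ0.le, Real.norm_of_nonneg hδ0.le,
            Real.norm_of_nonneg (by linarith : (0 : ℝ) ≤ E)]
      _ ≤ 2 * (2 * (‖k‖ * κ)) + δ := by gcongr; linarith
      _ < ε := by linarith
  · rw [hΨn]
    have h2 : ‖k * x (-1)‖ ≤ 2 * (‖k‖ * κ) := by
      rw [norm_mul]
      have h5 := norm_add_le (x (-1) - ψ (-1)) (ψ (-1))
      rw [sub_add_cancel] at h5
      have h6 := hxn (-1) hm1R
      linarith [mul_le_mul_of_nonneg_left (show ‖x (-1)‖ ≤ 2 * κ by linarith) hk0.le]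
    have h3 := Complex.norm_exp_sub_one_le (x := k * x (-1)) (by linarith)
    have h4 : ζ ≤ 1 := by linarith [mul_le_mul_of_nonneg_left hE2.le hζ0.le]
    calc ζ * ‖exp (k * x (-1)) - 1‖ ≤ 1 * (2 * (2 * (‖k‖ * κ))) := by gcongr; linarith
      _ < ε := by linarith
  · have h1 : ContinuousOn (fun u => k * x u) {u ∈ ball 0 R | r₂ ≤ ‖Ψ u‖} :=
      (hxd.continuousOn.const_mul k).mono (fun u hu => hu.1)
    refine (h1.const_add _).add (ContinuousOn.clog (continuousOn_const.sub h1.neg.cexp) ?_)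
    exact fun u hu => Or.inl (hslit u hu.2)
  · intro u hu hru
    have h0 : (1 - exp (-(k * x u))) ≠ 0 := by
      intro h0
      have := hslit u hru
      rw [h0] at this; simp at this
    rw [Complex.exp_add, Complex.exp_add, Complex.exp_log h0,
      Complex.exp_log (by exact_mod_cast hζ0.ne'), mul_sub, mul_one, mul_assoc (ζ : ℂ),
      ← Complex.exp_add, add_neg_cancel, Complex.exp_zero]
    simp only [hΨ]; ring
  · intro u hu u' hu' hru hru'
    have hru2 : r₂ ≤ ‖Ψ u'‖ := hr.le.trans hru'
    have a1 := abs_le.1 (Complex.abs_arg_le_pi_div_two_iff.2 (hslit u hru.ge).le)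
    have a2 := abs_le.1 (Complex.abs_arg_le_pi_div_two_iff.2 (hslit u' hru2).le)
    have b1 : (r₁ - ζ) / ζ ≤ Real.exp (k * x u').re := by
      rw [hΨn] at hru'
      have h2 := norm_sub_le (exp (k * x u')) 1
      rw [norm_one, Complex.norm_exp] at h2
      rw [div_le_iff₀ hζ0]
      linarith [mul_le_mul_of_nonneg_left h2 hζ0.le]
    have b2 : Real.exp (k * x u).re ≤ (r₂ + ζ) / ζ := by
      rw [hΨn] at hru
      have h2 := norm_sub_norm_le (exp (k * x u)) 1
      rw [norm_one, Complex.norm_exp] at h2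
      rw [le_div_iff₀ hζ0]
      linarith [mul_le_mul_of_nonneg_left h2 hζ0.le]
    have c1 : Real.log (r₁ - ζ) - Real.log ζ ≤ (k * x u').re := by
      rw [← Real.log_div (by linarith) hζ0.ne', ← Real.log_exp (k * x u').re]
      exact Real.log_le_log (div_pos (by linarith) hζ0) b1
    have c2 : (k * x u).re ≤ Real.log (r₂ + ζ) - Real.log ζ := by
      rw [← Real.log_div (by linarith) hζ0.ne', ← Real.log_exp (k * x u).re]
      exact Real.log_le_log (Real.exp_pos _) b2
    have c3 : D ≤ (k * x u').re - (k * x u).re := by linarith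
    rw [hkx, hkx] at c3
    have i1 := abs_le.1 (hxim u hu)
    have i2 := abs_le.1 (hxim u' hu')
    have d1 : D / 2 ≤ A * ((x u').re - (x u).re) := by
      have : 2 * Real.pi * N * ((x u').im - (x u).im) ≥ -(‖k‖ * (4 * κ)) := by
        have e1 : 2 * Real.pi * N * (-(4 * κ)) ≤ 2 * Real.pi * N * ((x u').im - (x u).im) := by
          gcongr; linarith [i1.2, i2.1]
        linarith [mul_le_mul_of_nonneg_right hkN hκ0.le]
      linarith
    have d2 : Real.pi * N * D / A ≤ 2 * Real.pi * N * ((x u').re - (x u).re) := by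
      rw [div_le_iff₀ hA1]
      linarith [mul_le_mul_of_nonneg_left d1 hNn]
    have d3 : Λ + 2 * Real.pi + D / 2 ≤ Real.pi * N * D / A := by
      rw [le_div_iff₀ hA1]; linarith
    have d4 : -(D / 2) ≤ A * ((x u').im - (x u).im) := by
      have e1 : A * (-(4 * κ)) ≤ A * ((x u').im - (x u).im) := by
        gcongr; linarith [i1.2, i2.1]
      linarith [mul_le_mul_of_nonneg_right hkA hκ0.le]
    simp only [Complex.add_im, Complex.log_im, hkxi]
    linarith [a1.1, a1.2, a2.1, a2.2]

theorem exists_holomorphic_log {g : ℂ → ℂ} {R : ℝ} (hR : 0 < R)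
    (hg : DifferentiableOn ℂ g (ball 0 R))
    (h0 : ∀ z ∈ ball (0 : ℂ) R, g z ≠ 0) :
    ∃ L : ℂ → ℂ, DifferentiableOn ℂ L (ball 0 R) ∧ ∀ z ∈ ball (0 : ℂ) R, exp (L z) = g z := by
  have hd : DifferentiableOn ℂ (fun z => deriv g z / g z) (ball 0 R) :=
    (hg.deriv isOpen_ball).div hg h0
  obtain ⟨L, hL⟩ := hd.isExactOn_ball
  have h0R : (0 : ℂ) ∈ ball (0 : ℂ) R := mem_ball_self hR
  have hder : ∀ z ∈ ball (0 : ℂ) R, HasDerivAt (fun z => exp (L z) / g z) 0 z := by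
    intro z hz
    have h1 := (hg.differentiableAt (isOpen_ball.mem_nhds hz)).hasDerivAt
    convert! (hL z hz).cexp.div h1 (h0 z hz) using 1
    have := h0 z hz
    field_simp
    ring
  have hconst : ∀ z ∈ ball (0 : ℂ) R, exp (L z) / g z = exp (L 0) / g 0 := by
    intro z hz
    exact isOpen_ball.is_const_of_deriv_eq_zero (convex_ball _ _).isPreconnected
      (fun z hz => (hder z hz).differentiableAt.differentiableWithinAt)
      (fun z hz => (hder z hz).deriv) hz h0R
  refine ⟨fun z => L z - L 0 + log (g 0), ?_, fun z hz => ?_⟩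
  · have hLd : DifferentiableOn ℂ L (ball 0 R) :=
      fun z hz => (hL z hz).differentiableAt.differentiableWithinAt
    exact (hLd.sub_const _).add_const _
  · have h1 := hconst z hz
    rw [div_eq_div_iff (h0 z hz) (h0 0 h0R)] at h1
    rw [Complex.exp_add, Complex.exp_sub, Complex.exp_log (h0 0 h0R), div_mul_eq_mul_div, h1]
    field_simp [Complex.exp_ne_zero]

theorem exists_last_time {f : ℝ → ℝ} {a b c : ℝ} (hab : a ≤ b) (hf : ContinuousOn f (Icc a b))
    (ha : f a ≤ c) (hb : c < f b) : ∃ s ∈ Ico a b, f s = c ∧ ∀ t ∈ Ioc s b, c < f t := by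
  have hcpt : IsCompact (Icc a b ∩ f ⁻¹' Iic c) :=
    isCompact_Icc.of_isClosed_subset (hf.preimage_isClosed_of_isClosed isClosed_Icc isClosed_Iic)
      inter_subset_left
  obtain ⟨s, ⟨hs, hsc⟩, hmax⟩ := hcpt.exists_isGreatest ⟨a, ⟨le_rfl, hab⟩, ha⟩
  have hsb : s < b := lt_of_le_of_ne hs.2 (by rintro rfl; exact absurd hsc (not_le.2 hb))
  have hgt : ∀ t ∈ Ioc s b, c < f t := by
    intro t ht
    by_contra! h
    exact absurd (hmax ⟨⟨hs.1.trans ht.1.le, ht.2⟩, h⟩) (not_le.2 ht.1)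
  refine ⟨s, ⟨hs.1, hsb⟩, ?_, hgt⟩
  by_contra hne
  have hlt : f s < c := lt_of_le_of_ne hsc hne
  obtain ⟨t, ht, htc⟩ := intermediate_value_Icc hsb.le (hf.mono (Icc_subset_Icc_left hs.1))
    ⟨hlt.le, hb.le⟩
  have : s < t := lt_of_le_of_ne ht.1 (by rintro rfl; exact hne htc)
  exact absurd htc (hgt t ⟨this, ht.2⟩).ne'

theorem root_of_unity_constant {q : ℕ} (hq : 1 ≤ q) {S : Set ℝ} (hS : IsPreconnected S)
    {r : ℝ → ℂ} (hr : ContinuousOn r S) (h1 : ∀ t ∈ S, r t ^ q = 1) {x y : ℝ} (hx : x ∈ S)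
    (hy : y ∈ S) : r x = r y := by
  have hfin : ({z : ℂ | z ^ q = 1}).Finite := by
    refine (Polynomial.nthRootsFinset q (1 : ℂ)).finite_toSet.subset fun z hz => ?_
    rw [Finset.mem_coe, Polynomial.mem_nthRootsFinset hq]
    exact hz
  exact hS.constant_of_mapsTo hfin.isDiscrete hr h1 hx hy

/-- A `q`-fold symmetric version of `exists_spiral_map`. -/
theorem exists_spiral_root {q : ℕ} (hq : 1 ≤ q) {ε : ℝ} (hε : 0 < ε) (hε1 : ε < 1) :
    ∃ (T P : ℂ → ℂ) (R : ℝ), 1 < R ∧ Differentiable ℂ T ∧ (∀ x, deriv T x ≠ 0) ∧ T 0 = 0 ∧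
      DifferentiableOn ℂ P (ball 0 R) ∧ InjOn P (ball 0 R) ∧ (∀ v ∈ ball (0 : ℂ) R, ‖P v‖ < 1) ∧
      P 0 = 0 ∧ deriv P 0 ≠ 0 ∧ (∀ v ∈ ball (0 : ℂ) R, T (P v ^ q) = v ^ q) ∧
      (∀ ω : ℂ, ω ^ q = 1 → ∀ v, P (ω * v) = ω * P v) ∧
      ‖P 1 - 1‖ < ε / 2 ∧ (∃ v, ‖v‖ = 1 ∧ ‖P v‖ < ε) ∧
      ∀ p : ℝ → ℂ, ContinuousOn p (Icc 0 1) → MapsTo p (Icc 0 1) (closedBall 0 1) → p 0 = 0 →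
        1 - ε / 2 ≤ ‖P (p 1)‖ →
        ∃ s ∈ Ico (0 : ℝ) 1, ∃ ℓ : ℝ → ℂ, ContinuousOn ℓ (Icc s 1) ∧
          (∀ t ∈ Icc s 1, exp (ℓ t) = P (p t) ∧ 1 - ε < ‖P (p t)‖) ∧
          (ℓ s).im + 4 * Real.pi ≤ (ℓ 1).im := by
  have hq0 : q ≠ 0 := by omega
  have hqC : (q : ℂ) ≠ 0 := by exact_mod_cast hq0
  have hroot : Tendsto (fun w : ℂ => exp (log w / q)) (nhds 1) (nhds 1) := by
    have : ContinuousAt (fun w : ℂ => exp (log w / q)) 1 :=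
      ((continuousAt_clog (by simp)).div_const _).cexp
    simpa [ContinuousAt] using this
  obtain ⟨ε₁, hε₁, hε₁'⟩ := Metric.tendsto_nhds_nhds.1 hroot (ε / 2) (by positivity)
  have hr : (1 - 3 * ε / 4) ^ q < (1 - ε / 2) ^ q :=
    pow_lt_pow_left₀ (by linarith) (by linarith) hq0
  have hr2 : (0 : ℝ) < (1 - 3 * ε / 4) ^ q := pow_pos (by linarith) q
  obtain ⟨T, Ψ, ℓ₀, R, hR, hT, hT', hT0, hΨ0, hΨd, hΨ1, hTΨ, hΨone, hΨm, hℓc, hℓ, hturn⟩ :=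
    exists_spiral_map (Λ := 4 * Real.pi * q) hr2 hr (show 0 < min ε₁ (ε ^ q) by positivity)
  have hR0 : 0 < R := by linarith
  have h0R : (0 : ℂ) ∈ ball (0 : ℂ) R := mem_ball_self hR0
  have hΨne : ∀ u ∈ ball (0 : ℂ) R, u ≠ 0 → Ψ u ≠ 0 := by
    intro u hu h0 h
    have := hTΨ u hu
    rw [h, hT0] at this
    exact h0 this.symm
  have hg : DifferentiableOn ℂ (dslope Ψ 0) (ball 0 R) :=
    (Complex.differentiableOn_dslope (isOpen_ball.mem_nhds h0R)).2 hΨd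
  have hgΨ : ∀ u, Ψ u = u * dslope Ψ 0 u := fun u => by
    have := sub_smul_dslope Ψ 0 u
    rw [hΨ0, sub_zero, sub_zero, smul_eq_mul] at this
    exact this.symm
  have hgne : ∀ u ∈ ball (0 : ℂ) R, dslope Ψ 0 u ≠ 0 := by
    intro u hu h
    rcases eq_or_ne u 0 with rfl | h0
    · rw [dslope_same] at h
      have h1 := (hT (Ψ 0)).hasDerivAt.comp 0
        (hΨd.differentiableAt (isOpen_ball.mem_nhds h0R)).hasDerivAt
      have h2 : HasDerivAt (T ∘ Ψ) 1 0 := by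
        refine (hasDerivAt_id (0 : ℂ)).congr_of_eventuallyEq ?_
        filter_upwards [isOpen_ball.mem_nhds h0R] with u hu using hTΨ u hu
      have := h1.unique h2
      rw [h, mul_zero] at this
      exact zero_ne_one this
    · exact hΨne u hu h0 (by rw [hgΨ, h, mul_zero])
  obtain ⟨l, hld, hl⟩ := exists_holomorphic_log hR0 hg hgne
  have h1R : (1 : ℂ) ∈ ball (0 : ℂ) R := by simpa using hR
  have hm1R : (-1 : ℂ) ∈ ball (0 : ℂ) R := by simpa using hR
  have hΨ1ne : Ψ 1 ≠ 0 := hΨne 1 h1R one_ne_zero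
  have hexpl1 : exp (l 1) = Ψ 1 := by rw [hl 1 h1R, hgΨ 1, one_mul]
  have hpow : ∀ z : ℂ, exp (z / q) ^ q = exp z := fun z => by
    rw [← Complex.exp_nat_mul, mul_div_cancel₀ _ hqC]
  set ω₀ : ℂ := exp ((log (Ψ 1) - l 1) / q) with hω₀
  have hω₀q : ω₀ ^ q = 1 := by
    rw [hω₀, hpow, Complex.exp_sub, Complex.exp_log hΨ1ne, hexpl1, div_self hΨ1ne]
  have hω₀ne : ω₀ ≠ 0 := Complex.exp_ne_zero _
  set P : ℂ → ℂ := fun v => ω₀ * v * exp (l (v ^ q) / q) with hP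
  obtain ⟨R', hR'1, hR'q⟩ : ∃ R' : ℝ, 1 < R' ∧ R' ^ q < R := by
    have h1 : Tendsto (fun r : ℝ => r ^ q) (nhdsWithin 1 (Ioi 1)) (nhds 1) := by
      have : Tendsto (fun r : ℝ => r ^ q) (nhds 1) (nhds (1 ^ q)) := (continuous_pow q).tendsto 1
      rw [one_pow] at this
      exact this.mono_left nhdsWithin_le_nhds
    have h2 : ∀ᶠ r in nhdsWithin (1 : ℝ) (Ioi 1), 1 < r := eventually_mem_nhdsWithin
    exact (h2.and (h1.eventually (gt_mem_nhds hR))).exists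
  have hmem : ∀ v ∈ ball (0 : ℂ) R', v ^ q ∈ ball (0 : ℂ) R := by
    intro v hv
    rw [mem_ball_zero_iff] at hv ⊢
    rw [norm_pow]
    exact (pow_le_pow_left₀ (norm_nonneg _) hv.le q).trans_lt hR'q
  have hPq : ∀ v ∈ ball (0 : ℂ) R', P v ^ q = Ψ (v ^ q) := by
    intro v hv
    simp only [hP]
    rw [mul_pow, mul_pow, hω₀q, hpow, hl _ (hmem v hv), one_mul, ← hgΨ]
  have hPd : DifferentiableOn ℂ P (ball 0 R') := by
    have h1 : DifferentiableOn ℂ (fun v : ℂ => l (v ^ q)) (ball 0 R') :=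
      hld.comp (by fun_prop) hmem
    exact (by fun_prop : DifferentiableOn ℂ (fun v : ℂ => ω₀ * v) (ball 0 R')).mul
      (h1.div_const _).cexp
  have hPlt : ∀ v ∈ ball (0 : ℂ) R', ‖P v‖ < 1 := by
    intro v hv
    have h1 := hΨ1 _ (hmem v hv)
    rw [← hPq v hv, norm_pow] at h1
    exact (pow_lt_one_iff_of_nonneg (norm_nonneg _) hq0).1 h1
  have h1R' : (1 : ℂ) ∈ ball (0 : ℂ) R' := by simpa using hR'1
  have hcb : closedBall (0 : ℂ) 1 ⊆ ball 0 R' := closedBall_subset_ball hR'1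
  have h0R' : (0 : ℂ) ∈ ball (0 : ℂ) R' := mem_ball_self (by linarith)
  refine ⟨T, P, R', hR'1, hT, hT', hT0, hPd, ?_, hPlt, by simp [hP], ?_, ?_, ?_, ?_, ?_, ?_⟩
  · intro v hv v' hv' h
    have h1 : v ^ q = v' ^ q := by
      rw [← hTΨ _ (hmem v hv), ← hTΨ _ (hmem v' hv'), ← hPq v hv, ← hPq v' hv', h]
    simp only [hP] at h
    rw [h1] at h
    exact mul_left_cancel₀ hω₀ne (mul_right_cancel₀ (Complex.exp_ne_zero _) h)
  · have h1 : DifferentiableAt ℂ (fun v : ℂ => l (v ^ q)) 0 :=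
      (hld.comp (by fun_prop) hmem : DifferentiableOn ℂ (fun v : ℂ => l (v ^ q)) (ball 0 R')).differentiableAt
        (isOpen_ball.mem_nhds h0R')
    have h2 := ((hasDerivAt_id (0 : ℂ)).const_mul ω₀).mul (h1.div_const (q : ℂ)).cexp.hasDerivAt
    have h3 : deriv P 0 = _ := h2.deriv
    rw [h3]
    simp [hω₀ne, Complex.exp_ne_zero]
  · intro v hv
    rw [hPq v hv, hTΨ _ (hmem v hv)]
  · intro ω hω v
    simp only [hP]
    rw [mul_pow, hω, one_mul]; ring
  · have h1 : P 1 = exp (log (Ψ 1) / q) := by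
      simp only [hP, hω₀]
      rw [one_pow, mul_one, ← Complex.exp_add]
      congr 1; ring
    rw [h1, ← dist_eq_norm]
    refine hε₁' ?_
    rw [dist_eq_norm]
    exact hΨone.trans_le (min_le_left _ _)
  · refine ⟨exp (Real.pi * I / q), ?_, ?_⟩
    · have : (Real.pi * I / q : ℂ) = ((Real.pi / q : ℝ) : ℂ) * I := by push_cast; ring
      rw [this, Complex.norm_exp_ofReal_mul_I]
    · have hmemv : exp (Real.pi * I / q) ∈ ball (0 : ℂ) R' := by
        have : (Real.pi * I / q : ℂ) = ((Real.pi / q : ℝ) : ℂ) * I := by push_cast; ring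
        rw [mem_ball_zero_iff, this, Complex.norm_exp_ofReal_mul_I]; exact hR'1
      have h1 := hPq _ hmemv
      rw [hpow, Complex.exp_pi_mul_I] at h1
      have h2 : ‖P (exp (Real.pi * I / q))‖ ^ q < ε ^ q := by
        rw [← norm_pow, h1]
        exact hΨm.trans_le (min_le_right _ _)
      exact lt_of_pow_lt_pow_left₀ q hε.le h2
  · intro p hp hpm hp0 hp1
    have hpb : ∀ t ∈ Icc (0 : ℝ) 1, p t ∈ ball (0 : ℂ) R' := fun t ht => hcb (hpm ht)
    have hPp : ContinuousOn (fun t => P (p t)) (Icc 0 1) := hPd.continuousOn.comp hp hpb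
    obtain ⟨s, hs, hs1, hs2⟩ := exists_last_time (f := fun t => ‖P (p t)‖) (c := 1 - 3 * ε / 4)
      zero_le_one hPp.norm (by simp [hp0, hP]; linarith) (by linarith)
    have hsub : Icc s 1 ⊆ Icc (0 : ℝ) 1 := Icc_subset_Icc_left hs.1
    have hge : ∀ t ∈ Icc s 1, 1 - 3 * ε / 4 ≤ ‖P (p t)‖ := by
      intro t ht
      rcases eq_or_lt_of_le ht.1 with rfl | h
      · exact hs1.ge
      · exact (hs2 t ⟨h, ht.2⟩).le
    have hΨp : ∀ t ∈ Icc (0 : ℝ) 1, ‖Ψ (p t ^ q)‖ = ‖P (p t)‖ ^ q := fun t ht => by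
      rw [← hPq _ (hpb t ht), norm_pow]
    have hgeΨ : ∀ t ∈ Icc s 1, (1 - 3 * ε / 4) ^ q ≤ ‖Ψ (p t ^ q)‖ := fun t ht => by
      rw [hΨp t (hsub ht)]
      exact pow_le_pow_left₀ (by linarith) (hge t ht) q
    have hc : ContinuousOn (fun t => ℓ₀ (p t ^ q)) (Icc s 1) :=
      hℓc.comp ((hp.mono hsub).pow q) fun t ht => ⟨hmem _ (hpb t (hsub ht)), hgeΨ t ht⟩
    have hrc : ContinuousOn (fun t => P (p t) * exp (-(ℓ₀ (p t ^ q) / q))) (Icc s 1) :=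
      (hPp.mono hsub).mul (hc.div_const _).neg.cexp
    have hr1 : ∀ t ∈ Icc s 1, (P (p t) * exp (-(ℓ₀ (p t ^ q) / q))) ^ q = 1 := by
      intro t ht
      rw [mul_pow, hPq _ (hpb t (hsub ht)), ← neg_div, hpow,
        ← hℓ _ (hmem _ (hpb t (hsub ht))) (hgeΨ t ht), ← Complex.exp_add]
      simp
    have hsI : s ∈ Icc s 1 := ⟨le_rfl, hs.2.le⟩
    have h1I : (1 : ℝ) ∈ Icc s 1 := ⟨hs.2.le, le_rfl⟩
    set c : ℂ := P (p s) * exp (-(ℓ₀ (p s ^ q) / q)) with hcdef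
    have hc0 : c ≠ 0 := by
      intro h
      have := hr1 s hsI
      rw [← hcdef, h, zero_pow hq0] at this
      exact zero_ne_one this
    refine ⟨s, hs, fun t => ℓ₀ (p t ^ q) / q + log c, (hc.div_const _).add_const _, ?_, ?_⟩
    · intro t ht
      refine ⟨?_, by linarith [hge t ht]⟩
      have := root_of_unity_constant hq isPreconnected_Icc hrc hr1 ht hsI
      rw [Complex.exp_add, Complex.exp_log hc0, hcdef, ← this, mul_left_comm, ← Complex.exp_add]
      simp
    · have h1 := hturn (p s ^ q) (hmem _ (hpb s (hsub hsI))) (p 1 ^ q)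
        (hmem _ (hpb 1 (hsub h1I))) (by rw [hΨp s (hsub hsI)]; congr 1) (by
          rw [hΨp 1 (hsub h1I)]; exact pow_le_pow_left₀ (by linarith) hp1 q)
      have hqR : (0 : ℝ) < q := by exact_mod_cast hq
      simp only [Complex.add_im, Complex.div_natCast_im]
      have h2 : (ℓ₀ (p s ^ q)).im / q + 4 * Real.pi ≤ (ℓ₀ (p 1 ^ q)).im / q := by
        rw [div_add' _ _ _ hqR.ne']
        gcongr
        linarith
      linarith

/-- The Taylor coefficients in time of the flow of the vector field `Y`. -/
def flowCoeff (Y : ℂ → ℂ) : ℕ → ℂ → ℂ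
  | 0 => fun z => z
  | k + 1 => fun z => Y z * deriv (flowCoeff Y k) z / (k + 1)

/-- The time-`t` flow of the vector field `Y`, as a power series in `t`. -/
def flowSeries (Y : ℂ → ℂ) (t : ℂ) (z : ℂ) : ℂ := ∑' k, flowCoeff Y k z * t ^ k

theorem differentiable_flowCoeff {Y : ℂ → ℂ} (hY : Differentiable ℂ Y) (k : ℕ) :
    Differentiable ℂ (flowCoeff Y k) := by
  induction k with
  | zero => exact differentiable_id
  | succ k ih =>
    have h1 : Differentiable ℂ (deriv (flowCoeff Y k)) :=
      fun z => (ih.analyticAt z).deriv.differentiableAt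
    exact (hY.mul h1).div_const _

theorem norm_flowCoeff_le_nested {Y : ℂ → ℂ} (hY : Differentiable ℂ Y) {M : ℝ}
    (hM : ∀ z : ℂ, ‖z‖ ≤ 4 → ‖Y z‖ ≤ M) {n : ℕ} (hn : 1 ≤ n) (j : ℕ) :
    ∀ z : ℂ, ‖z‖ ≤ 4 - j / n → ‖flowCoeff Y j z‖ ≤ 4 * ((M * n) ^ j / j.factorial) := by
  have hn0 : (0 : ℝ) < n := by exact_mod_cast hn
  have hM0 : 0 ≤ M := (norm_nonneg _).trans (hM 0 (by simp))
  induction j with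
  | zero => intro z hz; simpa [flowCoeff] using hz
  | succ j ih =>
    intro z hz
    have hj : ((j + 1 : ℕ) : ℝ) / n = j / n + 1 / n := by push_cast; ring
    rw [hj] at hz
    have h1n : (0 : ℝ) < 1 / n := by positivity
    have hjn : (0 : ℝ) ≤ j / n := by positivity
    have hd : ‖deriv (flowCoeff Y j) z‖ ≤ 4 * ((M * n) ^ j / j.factorial) / (1 / n) := by
      apply Complex.norm_deriv_le_of_forall_mem_sphere_norm_le h1n
        (differentiable_flowCoeff hY j).diffContOnCl
      intro w hw
      apply ih
      have : ‖w - z‖ = 1 / n := by simpa [dist_eq_norm] using hw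
      have h3 := norm_add_le (w - z) z
      rw [sub_add_cancel] at h3
      linarith
    have hYz : ‖Y z‖ ≤ M := hM z (by linarith)
    have hk : ‖((j : ℂ) + 1)‖ = (j : ℝ) + 1 := by
      have : ((j : ℂ) + 1) = ((j + 1 : ℕ) : ℂ) := by push_cast; rfl
      rw [this, Complex.norm_natCast]; push_cast; rfl
    calc ‖flowCoeff Y (j + 1) z‖ = ‖Y z‖ * ‖deriv (flowCoeff Y j) z‖ / ((j : ℝ) + 1) := by
          simp only [flowCoeff, norm_div, norm_mul, hk]
      _ ≤ M * (4 * ((M * n) ^ j / j.factorial) / (1 / n)) / ((j : ℝ) + 1) := by gcongr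
      _ = 4 * ((M * n) ^ (j + 1) / (j + 1).factorial) := by
          rw [Nat.factorial_succ]; push_cast; field_simp; ring

theorem norm_flowCoeff_le {Y : ℂ → ℂ} (hY : Differentiable ℂ Y) {M : ℝ}
    (hM : ∀ z : ℂ, ‖z‖ ≤ 4 → ‖Y z‖ ≤ M) (n : ℕ) {z : ℂ} (hz : ‖z‖ ≤ 3) :
    ‖flowCoeff Y n z‖ ≤ 4 * (Real.exp 1 * M) ^ n := by
  have hM0 : 0 ≤ M := (norm_nonneg _).trans (hM 0 (by simp))
  rcases Nat.eq_zero_or_pos n with rfl | hn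
  · simp [flowCoeff]; linarith
  · have hn0 : (0 : ℝ) < n := by exact_mod_cast hn
    have h1 := norm_flowCoeff_le_nested hY hM hn n z (by rw [div_self hn0.ne']; linarith)
    have h2 := Real.pow_div_factorial_le_exp (n : ℝ) hn0.le n
    calc _ ≤ _ := h1
      _ = 4 * (M ^ n * ((n : ℝ) ^ n / n.factorial)) := by rw [mul_pow]; ring
      _ ≤ 4 * (M ^ n * Real.exp n) := by gcongr
      _ = _ := by rw [mul_pow, ← Real.exp_nat_mul, mul_one]; ring

theorem exists_flowSeries_bound {Y : ℂ → ℂ} (hY : Differentiable ℂ Y) :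
    ∃ B : ℝ, 0 < B ∧ ∀ t : ℂ, ‖t‖ * B ≤ 1 / 2 →
      DifferentiableOn ℂ (flowSeries Y t) (ball 0 3) ∧
      ∀ z ∈ ball (0 : ℂ) 3, ‖flowSeries Y t z - z‖ ≤ 8 * B * ‖t‖ := by
  obtain ⟨M, hM⟩ := (isCompact_closedBall (0 : ℂ) 4).exists_bound_of_continuousOn
    hY.continuous.continuousOn
  have hM' : ∀ z : ℂ, ‖z‖ ≤ 4 → ‖Y z‖ ≤ M + 1 := fun z hz => by
    linarith [hM z (by simpa using hz)]
  have hM0 : 0 ≤ M := (norm_nonneg _).trans (hM 0 (by simp))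
  set B : ℝ := Real.exp 1 * (M + 1) with hB
  have hB0 : 0 < B := by positivity
  refine ⟨B, hB0, fun t ht => ?_⟩
  set x := ‖t‖ * B with hx
  have hx0 : 0 ≤ x := by positivity
  have hterm : ∀ (k : ℕ) (z : ℂ), z ∈ ball (0 : ℂ) 3 → ‖flowCoeff Y k z * t ^ k‖ ≤ 4 * x ^ k := by
    intro k z hz
    have h1 := norm_flowCoeff_le hY hM' k (z := z) (by simpa using (mem_ball_zero_iff.1 hz).le)
    rw [norm_mul, norm_pow, hx, mul_pow]
    calc _ ≤ 4 * (Real.exp 1 * (M + 1)) ^ k * ‖t‖ ^ k := by gcongr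
      _ = _ := by rw [← hB]; ring
  have hsum : Summable fun k : ℕ => 4 * x ^ k :=
    (summable_geometric_of_lt_one hx0 (by linarith)).mul_left 4
  refine ⟨?_, fun z hz => ?_⟩
  · exact Complex.differentiableOn_tsum_of_summable_norm hsum
      (fun k => ((differentiable_flowCoeff hY k).mul_const _).differentiableOn) isOpen_ball hterm
  · have hs : Summable fun k => flowCoeff Y k z * t ^ k :=
      Summable.of_norm_bounded hsum fun k => hterm k z hz
    have h2 : flowSeries Y t z - z = ∑' k, flowCoeff Y (k + 1) z * t ^ (k + 1) := by
      rw [flowSeries, hs.tsum_eq_zero_add]; simp [flowCoeff]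
    rw [h2]
    have h3 : HasSum (fun k : ℕ => 4 * x * x ^ k) (4 * x * (1 - x)⁻¹) :=
      (hasSum_geometric_of_lt_one hx0 (by linarith)).mul_left _
    have h4 := tsum_of_norm_bounded h3 (fun k => by
      have := hterm (k + 1) z hz
      rw [pow_succ x] at this
      linarith)
    refine h4.trans ?_
    have h5 : (1 - x)⁻¹ ≤ 2 := by
      rw [inv_le_comm₀ (by linarith) two_pos]; linarith
    calc 4 * x * (1 - x)⁻¹ ≤ 4 * x * 2 := by gcongr
      _ = 8 * B * ‖t‖ := by rw [hx]; ring

theorem flowSeries_conj {Y J : ℂ → ℂ} (hY : Differentiable ℂ Y) {R : ℝ} (hR : 1 < R)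
    (hJ : DifferentiableOn ℂ J (ball 0 R))
    (hYJ : ∀ v ∈ ball (0 : ℂ) R, Y (J v) = 2 * Real.pi * I * (v * deriv J v)) :
    ∃ c : ℝ, 0 < c ∧ ∀ t : ℂ, ‖t‖ < c → ∀ v : ℂ, ‖v‖ ≤ 1 →
      flowSeries Y t (J v) = J (exp (2 * Real.pi * I * t) * v) := by
  have hlog : 0 < Real.log R := Real.log_pos hR
  refine ⟨Real.log R / (2 * Real.pi), by positivity, fun t ht v hv => ?_⟩
  set c := Real.log R / (2 * Real.pi) with hc
  have hmem : ∀ s ∈ ball (0 : ℂ) c, exp (2 * Real.pi * I * s) * v ∈ ball (0 : ℂ) R := by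
    intro s hs
    rw [mem_ball_zero_iff] at hs ⊢
    have h1 : (2 * Real.pi * I * s).re ≤ 2 * Real.pi * ‖s‖ := by
      refine (re_le_norm _).trans (le_of_eq ?_)
      simp [abs_of_pos Real.pi_pos]
    have h2 : 2 * Real.pi * ‖s‖ < Real.log R := by
      rw [hc, lt_div_iff₀ (by positivity)] at hs; linarith
    rw [norm_mul, Complex.norm_exp]
    calc _ ≤ Real.exp (2 * Real.pi * I * s).re * 1 := by gcongr
      _ < Real.exp (Real.log R) := by rw [mul_one]; exact Real.exp_lt_exp.2 (h1.trans_lt h2)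
      _ = R := Real.exp_log (by linarith)
  set g : ℂ → ℂ := fun s => J (exp (2 * Real.pi * I * s) * v) with hg
  have hgd : ∀ s ∈ ball (0 : ℂ) c, HasDerivAt g (Y (g s)) s := by
    intro s hs
    have h1 := (hJ.differentiableAt (isOpen_ball.mem_nhds (hmem s hs))).hasDerivAt
    have h2 : HasDerivAt (fun s : ℂ => exp (2 * Real.pi * I * s) * v)
        (2 * Real.pi * I * (exp (2 * Real.pi * I * s) * v)) s := by
      convert! (((hasDerivAt_id s).const_mul (2 * Real.pi * I)).cexp.mul_const v) using 1
      simp; ring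
    convert! h1.comp s h2 using 1
    rw [hg]; simp only
    rw [hYJ _ (hmem s hs)]; ring
  have hiter : ∀ k : ℕ, ∀ s ∈ ball (0 : ℂ) c,
      iteratedDeriv k g s = k.factorial * flowCoeff Y k (g s) := by
    intro k
    induction k with
    | zero => intro s _; simp [flowCoeff]
    | succ k ih =>
      intro s hs
      rw [iteratedDeriv_succ]
      have h1 : iteratedDeriv k g =ᶠ[nhds s] fun s => k.factorial * flowCoeff Y k (g s) :=
        Filter.eventuallyEq_of_mem (isOpen_ball.mem_nhds hs) ih
      rw [h1.deriv_eq]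
      have h2 := ((differentiable_flowCoeff hY k (g s)).hasDerivAt.comp s (hgd s hs)).const_mul
        (k.factorial : ℂ)
      have h3 := h2.deriv
      simp only [Function.comp_def] at h3
      rw [h3, Nat.factorial_succ]
      simp only [flowCoeff]
      have : ((k : ℂ) + 1) ≠ 0 := Nat.cast_add_one_ne_zero k
      push_cast
      field_simp
  have hts := Complex.hasSum_taylorSeries_on_ball (f := g) (c := 0) (r := c)
    (fun s hs => (hgd s hs).differentiableAt.differentiableWithinAt) (z := t)
    (by simpa using ht)
  have h0 : (0 : ℂ) ∈ ball (0 : ℂ) c := mem_ball_self (by positivity)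
  have hfin := hts.tsum_eq
  rw [hg] at hfin
  simp only at hfin
  rw [← hfin, flowSeries]
  refine tsum_congr fun k => ?_
  rw [← hg, hiter k 0 h0, sub_zero, smul_eq_mul, smul_eq_mul]
  have : (k.factorial : ℂ) ≠ 0 := Nat.cast_ne_zero.2 k.factorial_ne_zero
  have hg0 : g 0 = J v := by simp [hg]
  rw [hg0]
  field_simp

/-- The data of one stage of the approximation scheme: `J` uniformizes a neighbourhood of the
current closed topological disk, `E` and `Y` are entire extensions of the conjugates by `J` of
`v ↦ v ^ q` and of the rotation vector field, and `f` is conjugate by `J` to the rotation by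
`a / q`. -/
structure Stage where
  E : ℂ → ℂ
  Y : ℂ → ℂ
  J : ℂ → ℂ
  f : ℂ → ℂ
  R : ℝ
  ρ : ℝ
  q : ℕ
  a : ℕ

/-- The multiplier of the rotation attached to a stage. -/
def Stage.mult (S : Stage) : ℂ := exp (2 * Real.pi * I * ((S.a : ℂ) / S.q))

/-- The relations between the data of a stage, with the bounds required of the `n`-th one. -/
structure Stage.Valid (n : ℕ) (S : Stage) : Prop where
  one_lt_R : 1 < S.R
  ρ_pos : 0 < S.ρ
  one_le_q : 1 ≤ S.q
  diff_E : Differentiable ℂ S.E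
  diff_Y : Differentiable ℂ S.Y
  diff_J : DifferentiableOn ℂ S.J (ball 0 S.R)
  inj_J : InjOn S.J (ball 0 S.R)
  J_zero : S.J 0 = 0
  deriv_J : deriv S.J 0 ≠ 0
  E_J : ∀ v ∈ ball (0 : ℂ) S.R, S.E (S.J v) = v ^ S.q
  Y_J : ∀ v ∈ ball (0 : ℂ) S.R, S.Y (S.J v) = 2 * Real.pi * I * (v * deriv S.J v)
  norm_J : ∀ v : ℂ, ‖v‖ ≤ 1 → ‖S.J v‖ ≤ 1
  tip_J : ∀ v : ℂ, ‖v‖ ≤ 1 → ‖v - 1‖ < S.ρ → 1 / 2 ≤ ‖S.J v‖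
  diff_f : DifferentiableOn ℂ S.f (ball 0 2)
  f_J : ∀ v : ℂ, ‖v‖ ≤ 1 → S.f (S.J v) = S.J (S.mult * v)
  norm_f : ∀ z ∈ ball (0 : ℂ) 2, ‖S.f z - z‖ ≤ 1 / 16 * (1 - (1 / 2) ^ n)

/-- The relation between consecutive stages: `S'` arises from `S` by restricting the uniformization
along `P`, whose image forces paths from `0` to the tip near `1` to wind around twice, while some
points near `0` have orbits that leave a fixed neighbourhood of `0`. -/
structure StepRel (n : ℕ) (S S' : Stage) (P : ℂ → ℂ) : Prop where
  cont_P : ContinuousOn P (closedBall 0 1)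
  maps_P : ∀ v : ℂ, ‖v‖ ≤ 1 → ‖P v‖ < 1
  P_zero : P 0 = 0
  J_P : ∀ v, S'.J v = S.J (P v)
  tip_P : ∀ v : ℂ, ‖v - 1‖ < S'.ρ → ‖P v - 1‖ < S.ρ
  spiral : ∃ ε : ℝ, 0 < ε ∧ ε < S.ρ ∧ ε < 1 ∧
    ∀ p : ℝ → ℂ, ContinuousOn p (Icc 0 1) → MapsTo p (Icc 0 1) (closedBall 0 1) → p 0 = 0 →
      ‖p 1 - 1‖ < S'.ρ →
      ∃ s ∈ Ico (0 : ℝ) 1, ∃ ℓ : ℝ → ℂ, ContinuousOn ℓ (Icc s 1) ∧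
        (∀ t ∈ Icc s 1, exp (ℓ t) = P (p t) ∧ 1 - ε < ‖P (p t)‖) ∧
        (ℓ s).im + 4 * Real.pi ≤ (ℓ 1).im
  escape : ∃ v : ℂ, ‖v‖ = 1 ∧ ‖S'.J v‖ < 1 / (n + 1) ∧
    ∃ k ≤ S'.q, 1 / 2 ≤ ‖S'.f^[k] (S'.J v)‖
  close : ∀ z ∈ ball (0 : ℂ) 2, ‖S'.f z - S.f z‖ ≤ (1 / 2) ^ (n + S.q) / 64
  rot : ∃ m : ℕ, n + 2 ≤ m ∧ S'.q = S.q * m ∧ S'.a = S.a * m + 1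

theorem Stage.Valid.f_iterate {n : ℕ} {S : Stage} (hS : S.Valid n) (k : ℕ) {v : ℂ} (hv : ‖v‖ ≤ 1) :
    S.f^[k] (S.J v) = S.J (S.mult ^ k * v) := by
  induction k with
  | zero => simp
  | succ k ih =>
    rw [Function.iterate_succ_apply', ih, hS.f_J, pow_succ']
    · congr 1; ring
    · have : ‖S.mult‖ = 1 := by
        rw [Stage.mult, Complex.norm_exp, show (2 * Real.pi * I * ((S.a : ℂ) / S.q)) =
          ((2 * Real.pi * (S.a / S.q) : ℝ) : ℂ) * I by push_cast; ring]
        simp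
      rwa [norm_mul, norm_pow, this, one_pow, one_mul]

theorem exists_rotation_near {v : ℂ} (hv : ‖v‖ = 1) {m : ℕ} (hm : 1 ≤ m) :
    ∃ j < m, ‖exp (2 * Real.pi * I * ((j : ℂ) / m)) * v - 1‖ ≤ 2 * Real.pi / m := by
  have hm0 : (0 : ℝ) < m := by exact_mod_cast hm
  have hpi := Real.pi_pos
  set x : ℝ := -arg v / (2 * Real.pi) with hx
  have hvx : v = exp (-(2 * Real.pi * Int.fract x * I : ℂ)) := by
    have h1 : ((arg v : ℝ) : ℂ) = -(2 * Real.pi * x : ℂ) := by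
      have : arg v = -(2 * Real.pi * x) := by rw [hx]; field_simp
      rw [this]; push_cast; ring
    conv_lhs => rw [← Complex.norm_mul_exp_arg_mul_I v, hv, h1]
    rw [ofReal_one, one_mul, Complex.exp_eq_exp_iff_exists_int]
    refine ⟨-⌊x⌋, ?_⟩
    have : (x : ℂ) = (⌊x⌋ : ℂ) + (Int.fract x : ℝ) := by
      exact_mod_cast (Int.floor_add_fract x).symm
    rw [this]; push_cast; ring
  set t := Int.fract x with ht
  have ht0 : 0 ≤ t := Int.fract_nonneg x
  have ht1 : t < 1 := Int.fract_lt_one x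
  refine ⟨⌊t * m⌋₊, ?_, ?_⟩
  · rw [Nat.floor_lt (by positivity)]
    nlinarith
  · set j := ⌊t * m⌋₊ with hj
    have h1 : (j : ℝ) ≤ t * m := Nat.floor_le (by positivity)
    have h2 : t * m < j + 1 := Nat.lt_floor_add_one _
    rw [hvx, ← Complex.exp_add]
    have h3 : (2 * Real.pi * I * ((j : ℂ) / m) + -(2 * Real.pi * t * I)) =
        I * ((2 * Real.pi * ((j - t * m) / m) : ℝ) : ℂ) := by
      have : (m : ℂ) ≠ 0 := by exact_mod_cast hm0.ne'
      push_cast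
      field_simp
      ring
    rw [h3]
    refine (Real.norm_exp_I_mul_ofReal_sub_one_le).trans ?_
    rw [Real.norm_eq_abs, abs_mul, abs_div, abs_of_pos (by positivity : (0 : ℝ) < 2 * Real.pi),
      abs_of_pos hm0, ← mul_div_assoc]
    have h4 : |(j : ℝ) - t * m| ≤ 1 := by rw [abs_le]; constructor <;> linarith
    exact div_le_div_of_nonneg_right (mul_le_of_le_one_right (by positivity) h4) hm0.le

theorem Stage.Valid.exists_step {n : ℕ} {S : Stage} (hS : S.Valid n) :
    ∃ (S' : Stage) (P : ℂ → ℂ), S'.Valid (n + 1) ∧ StepRel n S S' P := by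
  have hR0 : (0 : ℝ) < S.R := zero_lt_one.trans hS.one_lt_R
  have hq := hS.one_le_q
  have hq0 : (0 : ℝ) < S.q := by exact_mod_cast hq
  have hsubR : ball (0 : ℂ) 1 ⊆ ball 0 S.R := ball_subset_ball hS.one_lt_R.le
  have hcont0 : ContinuousAt S.J 0 :=
    (hS.diff_J.differentiableAt (isOpen_ball.mem_nhds (mem_ball_self hR0))).continuousAt
  obtain ⟨δ, hδ, hJδ⟩ := Metric.continuousAt_iff.1 hcont0 (1 / (n + 1)) (by positivity)
  obtain ⟨ε, hε, hε'⟩ := exists_between (show (0 : ℝ) < min (min S.ρ 1) δ from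
    lt_min (lt_min hS.ρ_pos one_pos) hδ)
  have hερ : ε < S.ρ := hε'.trans_le ((min_le_left _ _).trans (min_le_left _ _))
  have hε1 : ε < 1 := hε'.trans_le ((min_le_left _ _).trans (min_le_right _ _))
  have hεδ : ε < δ := hε'.trans_le (min_le_right _ _)
  obtain ⟨T, P, R, hR, hT, hT', hT0, hP, hPi, hPb, hP0, hP0', hTP, hPω, hP1, ⟨v₀, hv₀, hPv₀⟩, hsp⟩ :=
    exists_spiral_root hq hε hε1
  have hsub1 : ∀ v : ℂ, ‖v‖ ≤ 1 → v ∈ ball (0 : ℂ) R := fun v hv => by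
    rw [mem_ball_zero_iff]; linarith
  have hPR : ∀ v ∈ ball (0 : ℂ) R, P v ∈ ball (0 : ℂ) S.R := fun v hv =>
    hsubR (mem_ball_zero_iff.2 (hPb v hv))
  have hcontP1 : ContinuousAt P 1 :=
    (hP.differentiableAt (isOpen_ball.mem_nhds (hsub1 1 (by simp)))).continuousAt
  obtain ⟨ρ', hρ', hPρ⟩ := Metric.continuousAt_iff.1 hcontP1 (ε / 2 - ‖P 1 - 1‖) (by linarith)
  have htip : ∀ v : ℂ, ‖v - 1‖ < ρ' → ‖P v - 1‖ < ε / 2 := by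
    intro v hv
    have h1 := hPρ (show dist v 1 < ρ' by rwa [dist_eq_norm])
    rw [dist_eq_norm] at h1
    have h2 := norm_sub_le_norm_sub_add_norm_sub (P v) (P 1) 1
    linarith
  -- the new vector field
  set Y' : ℂ → ℂ := fun z => dslope T 0 (S.E z) / deriv T (S.E z) * S.Y z with hY'def
  have hτ : Differentiable ℂ (dslope T 0) := by
    rw [← differentiableOn_univ]
    exact (Complex.differentiableOn_dslope univ_mem).2 hT.differentiableOn
  have hTd : Differentiable ℂ (deriv T) := fun z => (hT.analyticAt z).deriv.differentiableAt
  have hY' : Differentiable ℂ Y' :=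
    ((hτ.comp hS.diff_E).div (hTd.comp hS.diff_E) fun z => hT' _).mul hS.diff_Y
  set J' : ℂ → ℂ := fun v => S.J (P v) with hJ'def
  have hJ'd : DifferentiableOn ℂ J' (ball 0 R) := hS.diff_J.comp hP hPR
  have hJ'der : ∀ v ∈ ball (0 : ℂ) R, HasDerivAt J' (deriv S.J (P v) * deriv P v) v := by
    intro v hv
    exact (hS.diff_J.differentiableAt (isOpen_ball.mem_nhds (hPR v hv))).hasDerivAt.comp v
      (hP.differentiableAt (isOpen_ball.mem_nhds hv)).hasDerivAt
  have hYJ' : ∀ v ∈ ball (0 : ℂ) R, Y' (J' v) = 2 * Real.pi * I * (v * deriv J' v) := by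
    intro v hv
    rw [(hJ'der v hv).deriv]
    simp only [hY'def, hJ'def]
    rw [hS.E_J _ (hPR v hv), hS.Y_J _ (hPR v hv)]
    rcases eq_or_ne v 0 with rfl | hv0
    · simp [hP0]
    have hPv : P v ≠ 0 := by
      intro h
      exact hv0 (hPi hv (mem_ball_self (by linarith)) (h.trans hP0.symm))
    have h1 : HasDerivAt (fun v => T (P v ^ S.q))
        (deriv T (P v ^ S.q) * (S.q * P v ^ (S.q - 1) * deriv P v)) v := by
      exact (hT (P v ^ S.q)).hasDerivAt.comp v
        ((hP.differentiableAt (isOpen_ball.mem_nhds hv)).hasDerivAt.pow S.q)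
    have h2 : HasDerivAt (fun v => T (P v ^ S.q)) (S.q * v ^ (S.q - 1)) v :=
      (hasDerivAt_pow S.q v).congr_of_eventuallyEq
        (Filter.eventuallyEq_of_mem (isOpen_ball.mem_nhds hv) hTP)
    have h3 := h1.unique h2
    have hqC : (S.q : ℂ) ≠ 0 := by exact_mod_cast hq0.ne'
    have h4 : deriv T (P v ^ S.q) * (P v ^ (S.q - 1) * deriv P v) = v ^ (S.q - 1) := by
      apply mul_left_cancel₀ hqC
      rw [← h3]; ring
    have hTv := hT' (P v ^ S.q)
    rw [dslope_of_ne _ (pow_ne_zero _ hPv), slope_def_field, hT0, sub_zero, sub_zero, hTP v hv]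
    have h5 : v ^ S.q = v * v ^ (S.q - 1) := by rw [← pow_succ', Nat.sub_add_cancel hq]
    have h6 : P v ^ S.q = P v * P v ^ (S.q - 1) := by rw [← pow_succ', Nat.sub_add_cancel hq]
    have hPq : P v ^ (S.q - 1) ≠ 0 := pow_ne_zero _ hPv
    rw [h5, ← h4]
    rw [div_div, div_mul_eq_mul_div, div_eq_iff (mul_ne_zero (pow_ne_zero _ hPv) hTv), h6]
    ring
  obtain ⟨B, hB, hflow⟩ := exists_flowSeries_bound hY'
  obtain ⟨c, hc, hconj⟩ := flowSeries_conj hY' hR hJ'd hYJ'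
  -- the new denominator
  set κ : ℝ := min (min (1 / (2 * B)) c) (min ((1 / 2) ^ (n + S.q) / 64 / (8 * B)) (ρ' / (2 * Real.pi)))
    with hκ
  have hκ0 : 0 < κ := by
    have := Real.pi_pos
    exact lt_min (lt_min (by positivity) hc) (lt_min (by positivity) (by positivity))
  obtain ⟨m₀, hm₀⟩ := exists_nat_gt (1 / κ)
  set m : ℕ := max (n + 2) m₀ with hm
  have hm2 : n + 2 ≤ m := le_max_left _ _
  have hm1 : 1 ≤ m := by omega
  have hmR : (0 : ℝ) < m := by exact_mod_cast hm1
  have hmκ : 1 / (m : ℝ) < κ := by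
    rw [one_div_lt hmR hκ0]
    exact hm₀.trans_le (by exact_mod_cast le_max_right _ _)
  set t : ℂ := 1 / ((S.q * m : ℕ) : ℂ) with htdef
  have htn : ‖t‖ ≤ 1 / m := by
    rw [htdef, norm_div, norm_one, Complex.norm_natCast]
    push_cast
    apply one_div_le_one_div_of_le hmR
    have : (1 : ℝ) ≤ S.q := by exact_mod_cast hq
    exact le_mul_of_one_le_left hmR.le this
  have htκ : ‖t‖ < κ := htn.trans_lt hmκ
  have ht1 : ‖t‖ * B ≤ 1 / 2 := by
    have : ‖t‖ ≤ 1 / (2 * B) := htκ.le.trans ((min_le_left _ _).trans (min_le_left _ _))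
    calc ‖t‖ * B ≤ 1 / (2 * B) * B := by gcongr
      _ = 1 / 2 := by field_simp
  have ht2 : ‖t‖ < c := htκ.trans_le ((min_le_left _ _).trans (min_le_right _ _))
  have ht3 : 8 * B * ‖t‖ ≤ (1 / 2) ^ (n + S.q) / 64 := by
    have : ‖t‖ ≤ (1 / 2) ^ (n + S.q) / 64 / (8 * B) :=
      htκ.le.trans ((min_le_right _ _).trans (min_le_left _ _))
    rw [le_div_iff₀ (by positivity)] at this
    linarith
  have ht4 : 2 * Real.pi / m < ρ' := by
    have : 1 / (m : ℝ) < ρ' / (2 * Real.pi) :=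
      hmκ.trans_le ((min_le_right _ _).trans (min_le_right _ _))
    rw [lt_div_iff₀ (by positivity)] at this
    rw [div_eq_mul_one_div]; linarith
  obtain ⟨hSd, hSb⟩ := hflow t ht1
  have hf3 : ∀ z ∈ ball (0 : ℂ) 2, S.f z ∈ ball (0 : ℂ) 3 := by
    intro z hz
    have h1 := hS.norm_f z hz
    have h2 : (0 : ℝ) < (1 / 2) ^ n := by positivity
    rw [mem_ball_zero_iff] at hz ⊢
    have h3 := norm_add_le (S.f z - z) z
    rw [sub_add_cancel] at h3
    linarith
  have hqC : (S.q : ℂ) ≠ 0 := by exact_mod_cast hq0.ne'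
  have hmC : (m : ℂ) ≠ 0 := by exact_mod_cast hmR.ne'
  let S' : Stage :=
    { E := fun z => T (S.E z) ^ m, Y := Y', J := J', f := fun z => flowSeries Y' t (S.f z)
      R := R, ρ := ρ', q := S.q * m, a := S.a * m + 1 }
  have hmultq : S.mult ^ S.q = 1 := by
    rw [Stage.mult, ← Complex.exp_nat_mul, Complex.exp_eq_one_iff]
    refine ⟨S.a, ?_⟩
    field_simp
    push_cast
    ring
  have hmult1 : ‖S.mult‖ = 1 := Complex.norm_eq_one_of_pow_eq_one hmultq (by omega)
  have hmult' : S'.mult = exp (2 * Real.pi * I * t) * S.mult := by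
    simp only [Stage.mult, S', htdef]
    rw [← Complex.exp_add]
    congr 1
    push_cast
    field_simp
    ring
  have hclose : ∀ z ∈ ball (0 : ℂ) 2, ‖S'.f z - S.f z‖ ≤ (1 / 2) ^ (n + S.q) / 64 :=
    fun z hz => (hSb _ (hf3 z hz)).trans ht3
  have hP1' : ∀ v : ℂ, ‖v‖ ≤ 1 → ‖P v‖ < 1 := fun v hv => hPb v (hsub1 v hv)
  have hV : S'.Valid (n + 1) :=
    { one_lt_R := hR
      ρ_pos := hρ'
      one_le_q := Nat.mul_pos hq hm1
      diff_E := (hT.comp hS.diff_E).pow m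
      diff_Y := hY'
      diff_J := hJ'd
      inj_J := hS.inj_J.comp hPi hPR
      J_zero := by simp [S', hJ'def, hP0, hS.J_zero]
      deriv_J := by
        have h := (hJ'der 0 (mem_ball_self (by linarith))).deriv
        rw [hP0] at h
        change deriv J' 0 ≠ 0
        rw [h]
        exact mul_ne_zero hS.deriv_J hP0'
      E_J := by
        intro v hv
        change T (S.E (S.J (P v))) ^ m = v ^ (S.q * m)
        rw [hS.E_J _ (hPR v hv), hTP v hv, pow_mul]
      Y_J := hYJ'
      norm_J := fun v hv => hS.norm_J _ (hP1' v hv).le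
      tip_J := fun v hv hv1 => hS.tip_J _ (hP1' v hv).le (by linarith [htip v hv1])
      diff_f := hSd.comp hS.diff_f hf3
      f_J := by
        intro v hv
        change flowSeries Y' t (S.f (S.J (P v))) = S.J (P (S'.mult * v))
        have hn : ‖S.mult * v‖ ≤ 1 := by rwa [norm_mul, hmult1, one_mul]
        rw [hS.f_J _ (hP1' v hv).le, ← hPω _ hmultq, hmult', mul_assoc]
        exact hconj t ht2 (S.mult * v) hn
      norm_f := by
        intro z hz
        have h1 := hclose z hz
        have h2 := hS.norm_f z hz
        have h3 := norm_sub_le_norm_sub_add_norm_sub (S'.f z) (S.f z) z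
        have h4 : ((1 : ℝ) / 2) ^ (n + S.q) ≤ (1 / 2) ^ n :=
          pow_le_pow_of_le_one (by norm_num) (by norm_num) (by omega)
        have h5 : (0 : ℝ) < (1 / 2) ^ n := by positivity
        rw [pow_succ]
        linarith }
  refine ⟨S', P, hV, ?_⟩
  refine
    { cont_P := hP.continuousOn.mono fun v hv => hsub1 v (by simpa using hv)
      maps_P := hP1'
      P_zero := hP0
      J_P := fun v => rfl
      tip_P := fun v hv => by linarith [htip v hv]
      spiral := ⟨ε, hε, hερ, hε1, fun p hp hpm hp0 hp1 => ?_⟩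
      escape := ⟨v₀, hv₀, ?_, ?_⟩
      close := hclose
      rot := ⟨m, hm2, rfl, rfl⟩ }
  · apply hsp p hp hpm hp0
    have h1 := htip _ hp1
    have h2 := norm_sub_norm_le 1 (1 - P (p 1))
    rw [sub_sub_cancel, norm_one, norm_sub_rev] at h2
    linarith
  · have := hJδ (show dist (P v₀) 0 < δ by rw [dist_zero_right]; linarith)
    rwa [hS.J_zero, dist_zero_right] at this
  · obtain ⟨j, hj, hjv⟩ := exists_rotation_near hv₀ hm1
    refine ⟨j * S.q, ?_, ?_⟩
    · change j * S.q ≤ S.q * m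
      rw [mul_comm]
      exact Nat.mul_le_mul_left _ hj.le
    · rw [hV.f_iterate _ hv₀.le]
      have h1 : S'.mult ^ (j * S.q) = exp (2 * Real.pi * I * ((j : ℂ) / m)) := by
        rw [hmult', mul_pow, mul_comm j, pow_mul S.mult, hmultq, one_pow, mul_one,
          ← Complex.exp_nat_mul, htdef]
        congr 1
        push_cast
        field_simp
      rw [h1]
      apply hV.tip_J
      · rw [norm_mul, hv₀, mul_one, show (2 * Real.pi * I * ((j : ℂ) / m)) =
          ((2 * Real.pi * (j / m) : ℝ) : ℂ) * I by push_cast; ring,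
          Complex.norm_exp_ofReal_mul_I]
      · exact hjv.trans_lt ht4

theorem isConnected_iInter_of_antitone {X : Type*} [TopologicalSpace X] [T2Space X]
    {s : ℕ → Set X} (hs : Antitone s) (hc : ∀ n, IsCompact (s n)) (hconn : ∀ n, IsConnected (s n)) :
    IsConnected (⋂ n, s n) := by
  have hdir : Directed (fun x1 x2 => x1 ⊇ x2) s := hs.directed_ge
  have hcl : IsClosed (⋂ n, s n) := isClosed_iInter fun n => (hc n).isClosed
  refine ⟨IsCompact.nonempty_iInter_of_sequence_nonempty_isCompact_isClosed s
    (fun n => hs n.le_succ) (fun n => (hconn n).nonempty) (hc 0) fun n => (hc n).isClosed, ?_⟩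
  rw [isPreconnected_iff_subset_of_fully_disjoint_closed hcl]
  intro u v hu hv huv hd
  have hcK : IsCompact (⋂ n, s n) := (hc 0).of_isClosed_subset hcl (iInter_subset s 0)
  have hd' : Disjoint ((⋂ n, s n) ∩ u) ((⋂ n, s n) ∩ v) :=
    hd.mono inter_subset_right inter_subset_right
  obtain ⟨U, V, hU, hV, hUu, hVv, hUV⟩ := SeparatedNhds.of_isCompact_isCompact
    (hcK.inter_right hu) (hcK.inter_right hv) hd'
  obtain ⟨n, hn⟩ := exists_subset_nhds_of_isCompact hdir hc (U := U ∪ V) (fun x hx =>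
    (hU.union hV).mem_nhds ((huv hx).imp (fun h => hUu ⟨hx, h⟩) (fun h => hVv ⟨hx, h⟩)))
  rcases IsPreconnected.subset_or_subset hU hV hUV hn (hconn n).isPreconnected with h | h
  · left
    intro x hx
    refine (huv hx).resolve_right fun hxv => ?_
    exact disjoint_left.1 hUV (h (iInter_subset s n hx)) (hVv ⟨hx, hxv⟩)
  · right
    intro x hx
    refine (huv hx).resolve_left fun hxu => ?_
    exact disjoint_left.1 hUV (hUu ⟨hx, hxu⟩) (h (iInter_subset s n hx))

theorem isPreconnected_one_lt_norm : IsPreconnected {z : ℂ | 1 < ‖z‖} := by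
  have h : exp '' {w : ℂ | 0 < w.re} = {z : ℂ | 1 < ‖z‖} := by
    ext z
    constructor
    · rintro ⟨w, hw, rfl⟩
      simpa [Complex.norm_exp] using hw
    · intro hz
      have hz' : 1 < ‖z‖ := hz
      have hz0 : z ≠ 0 := norm_pos_iff.1 (by linarith)
      exact ⟨log z, by simpa [Complex.log_re] using Real.log_pos hz', Complex.exp_log hz0⟩
  rw [← h]
  exact (convex_halfSpace_re_gt 0).isPreconnected.image _ Complex.continuous_exp.continuousOn

/-- The closed topological disk attached to a stage. -/
def Stage.disk (S : Stage) : Set ℂ := S.J '' closedBall 0 1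

namespace Stage.Valid

variable {n : ℕ} {S : Stage}

theorem closedBall_subset (hS : S.Valid n) : closedBall (0 : ℂ) 1 ⊆ ball 0 S.R :=
  closedBall_subset_ball hS.one_lt_R

theorem isCompact_disk (hS : S.Valid n) : IsCompact S.disk :=
  (isCompact_closedBall 0 1).image_of_continuousOn (hS.diff_J.continuousOn.mono hS.closedBall_subset)

theorem isConnected_disk (hS : S.Valid n) : IsConnected S.disk :=
  ((convex_closedBall (0 : ℂ) 1).isConnected ⟨0, by simp⟩).image _
    (hS.diff_J.continuousOn.mono hS.closedBall_subset)

theorem zero_mem_disk (hS : S.Valid n) : (0 : ℂ) ∈ S.disk := ⟨0, by simp, hS.J_zero⟩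

theorem norm_le_of_mem_disk (hS : S.Valid n) {z : ℂ} (hz : z ∈ S.disk) : ‖z‖ ≤ 1 := by
  obtain ⟨v, hv, rfl⟩ := hz
  exact hS.norm_J v (by simpa using hv)

theorem isOpen_image_J (hS : S.Valid n) {s : Set ℂ} (hs : s ⊆ ball 0 S.R) (ho : IsOpen s) :
    IsOpen (S.J '' s) := by
  have hR := hS.one_lt_R
  rcases (hS.diff_J.analyticOnNhd isOpen_ball).is_constant_or_isOpen
    (convex_ball _ _).isPreconnected with ⟨w, hw⟩ | h
  · exfalso
    have h0 : (0 : ℂ) ∈ ball (0 : ℂ) S.R := hS.closedBall_subset (by simp)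
    have h1 : (1 : ℂ) ∈ ball (0 : ℂ) S.R := hS.closedBall_subset (by simp)
    exact zero_ne_one (hS.inj_J h0 h1 ((hw 0 h0).trans (hw 1 h1).symm))
  · exact h s hs ho

theorem exists_one_lt_norm_of_component (hS : S.Valid n) {z : ℂ} (hz : z ∉ S.disk) :
    ∃ w ∈ connectedComponentIn S.diskᶜ z, 1 < ‖w‖ := by
  by_contra! hcon
  set O := connectedComponentIn S.diskᶜ z with hO
  have hopen : IsOpen S.diskᶜ := hS.isCompact_disk.isClosed.isOpen_compl
  have hOo : IsOpen O := hopen.connectedComponentIn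
  have hzO : z ∈ O := mem_connectedComponentIn hz
  have hOsub : O ⊆ S.diskᶜ := connectedComponentIn_subset _ _
  have hfr : frontier O ⊆ S.disk := by
    intro x hx
    by_contra hxd
    have hxO : x ∈ connectedComponentIn S.diskᶜ x := mem_connectedComponentIn hxd
    obtain ⟨y, hy, hyO⟩ := mem_closure_iff.1 (frontier_subset_closure hx) _
      (hopen.connectedComponentIn (x := x)) hxO
    have h1 := connectedComponentIn_eq hy
    have h2 := connectedComponentIn_eq hyO
    rw [h1, ← h2, ← hO] at hxO
    rw [hOo.frontier_eq] at hx
    exact hx.2 hxO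
  have hbdd : Bornology.IsBounded O :=
    isBounded_closedBall.subset fun w hw => mem_closedBall_zero_iff.2 (hcon w hw)
  have hE : ∀ w ∈ S.disk, ‖S.E w‖ ≤ 1 := by
    rintro _ ⟨v, hv, rfl⟩
    rw [hS.E_J _ (hS.closedBall_subset hv), norm_pow]
    exact pow_le_one₀ (norm_nonneg _) (by simpa using hv)
  have hmax : ∀ w ∈ closure O, ‖S.E w‖ ≤ 1 := fun w hw =>
    Complex.norm_le_of_forall_mem_frontier_norm_le hbdd hS.diff_E.diffContOnCl
      (fun w hw => hE w (hfr hw)) hw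
  have hne : O ≠ univ := by
    intro h
    have : (2 : ℂ) ∈ O := h ▸ mem_univ _
    have := hcon _ this
    norm_num at this
  obtain ⟨x, hx⟩ := nonempty_frontier_iff.2 ⟨⟨z, hzO⟩, hne⟩
  have hxJ : x ∈ S.J '' ball 0 S.R := image_mono hS.closedBall_subset (hfr hx)
  obtain ⟨_, ⟨v, hv, rfl⟩, hyO⟩ := mem_closure_iff.1 (frontier_subset_closure hx) _
    (hS.isOpen_image_J Subset.rfl isOpen_ball) hxJ
  have hv1 : 1 < ‖v‖ := by
    by_contra! h
    exact hOsub hyO ⟨v, by simpa using h, rfl⟩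
  have h1 := hmax _ (subset_closure hyO)
  rw [hS.E_J v hv, norm_pow] at h1
  exact absurd h1 (not_le.2 (one_lt_pow₀ hv1 (by have := hS.one_le_q; omega)))

theorem isPreconnected_compl_disk (hS : S.Valid n) : IsPreconnected S.diskᶜ := by
  apply isPreconnected_of_forall (2 : ℂ)
  intro z hz
  obtain ⟨w, hw, hw1⟩ := hS.exists_one_lt_norm_of_component hz
  refine ⟨{z : ℂ | 1 < ‖z‖} ∪ connectedComponentIn S.diskᶜ z, ?_, Or.inl ?_,
    Or.inr (mem_connectedComponentIn hz), IsPreconnected.union w hw1 hw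
      isPreconnected_one_lt_norm isPreconnected_connectedComponentIn⟩
  · apply union_subset _ (connectedComponentIn_subset _ _)
    intro x hx hxd
    exact absurd (hS.norm_le_of_mem_disk hxd) (not_le.2 hx)
  · change 1 < ‖(2 : ℂ)‖
    norm_num

end Stage.Valid

/-- A sequence of stages, each obtained from the previous one by precomposing the uniformization
with `P n`. -/
structure IsTower (S : ℕ → Stage) (P : ℕ → ℂ → ℂ) : Prop where
  valid : ∀ n, (S n).Valid n
  step : ∀ n, StepRel n (S n) (S (n + 1)) (P n)

theorem exists_isTower : ∃ S P, IsTower S P := by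
  let S₀ : Stage := { E := fun z => z, Y := fun z => 2 * Real.pi * I * z, J := fun z => z,
                      f := fun z => z, R := 2, ρ := 1 / 2, q := 1, a := 0 }
  have h0 : S₀.Valid 0 :=
    { one_lt_R := by norm_num [S₀]
      ρ_pos := by norm_num [S₀]
      one_le_q := le_rfl
      diff_E := differentiable_id
      diff_Y := differentiable_id.const_mul _
      diff_J := differentiableOn_id
      inj_J := injOn_id _
      J_zero := rfl
      deriv_J := by simp [S₀]
      E_J := by simp [S₀]
      Y_J := by simp [S₀]
      norm_J := fun v hv => hv
      tip_J := by
        intro v _ hv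
        change ‖v - 1‖ < 1 / 2 at hv
        change 1 / 2 ≤ ‖v‖
        have := norm_sub_norm_le 1 (1 - v)
        rw [sub_sub_cancel, norm_one, norm_sub_rev] at this
        linarith
      diff_f := differentiableOn_id
      f_J := by simp [S₀, Stage.mult]
      norm_f := by simp [S₀] }
  choose nxt P hP using fun (x : (n : ℕ) × {S : Stage // S.Valid n}) => x.2.2.exists_step
  let seq : ∀ n, {S : Stage // S.Valid n} := fun n =>
    Nat.rec ⟨S₀, h0⟩ (fun n x => ⟨nxt ⟨n, x⟩, (hP ⟨n, x⟩).1⟩) n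
  exact ⟨fun n => (seq n).1, fun n => P ⟨n, seq n⟩, fun n => (seq n).2, fun n => (hP ⟨n, seq n⟩).2⟩

/-- The intersection of the disks of a tower. -/
def towerCore (S : ℕ → Stage) : Set ℂ := ⋂ n, (S n).disk

namespace IsTower

variable {S : ℕ → Stage} {P : ℕ → ℂ → ℂ}

theorem disk_succ_subset (h : IsTower S P) (n : ℕ) :
    (S (n + 1)).disk ⊆ (S n).J '' ball 0 1 := by
  rintro _ ⟨v, hv, rfl⟩
  rw [(h.step n).J_P]
  exact ⟨_, by simpa using (h.step n).maps_P v (by simpa using hv), rfl⟩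

theorem antitone_disk (h : IsTower S P) : Antitone fun n => (S n).disk :=
  antitone_nat_of_succ_le fun n => (h.disk_succ_subset n).trans (image_mono ball_subset_closedBall)

theorem isCompact_core (h : IsTower S P) : IsCompact (towerCore S) :=
  (h.valid 0).isCompact_disk.of_isClosed_subset
    (isClosed_iInter fun n => (h.valid n).isCompact_disk.isClosed) (iInter_subset _ 0)

theorem isConnected_core (h : IsTower S P) : IsConnected (towerCore S) :=
  isConnected_iInter_of_antitone h.antitone_disk (fun n => (h.valid n).isCompact_disk)
    fun n => (h.valid n).isConnected_disk

theorem zero_mem_core (h : IsTower S P) : (0 : ℂ) ∈ towerCore S :=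
  mem_iInter.2 fun n => (h.valid n).zero_mem_disk

theorem norm_le_of_mem_core (h : IsTower S P) {z : ℂ} (hz : z ∈ towerCore S) : ‖z‖ ≤ 1 :=
  (h.valid 0).norm_le_of_mem_disk (mem_iInter.1 hz 0)

theorem isConnected_compl_core (h : IsTower S P) : IsConnected (towerCore S)ᶜ := by
  have h2 : ∀ n, (2 : ℂ) ∈ (S n).diskᶜ := fun n hn => by
    have := (h.valid n).norm_le_of_mem_disk hn
    norm_num at this
  rw [towerCore, compl_iInter]
  exact ⟨⟨2, mem_iUnion.2 ⟨0, h2 0⟩⟩, isPreconnected_iUnion ⟨2, mem_iInter.2 h2⟩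
    fun n => (h.valid n).isPreconnected_compl_disk⟩

theorem exists_mem_core_half_le_norm (h : IsTower S P) : ∃ z ∈ towerCore S, 1 / 2 ≤ ‖z‖ := by
  have hcl : IsClosed {z : ℂ | 1 / 2 ≤ ‖z‖} := isClosed_le continuous_const continuous_norm
  obtain ⟨z, hz⟩ := IsCompact.nonempty_iInter_of_sequence_nonempty_isCompact_isClosed
    (fun n => (S n).disk ∩ {z : ℂ | 1 / 2 ≤ ‖z‖})
    (fun n => inter_subset_inter_left _ (h.antitone_disk n.le_succ))
    (fun n => ⟨(S n).J 1, ⟨1, by simp, rfl⟩,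
      (h.valid n).tip_J 1 (by simp) (by simpa using (h.valid n).ρ_pos)⟩)
    ((h.valid 0).isCompact_disk.inter_right hcl)
    (fun n => (h.valid n).isCompact_disk.isClosed.inter hcl)
  rw [mem_iInter] at hz
  exact ⟨z, mem_iInter.2 fun n => (hz n).1, (hz 0).2⟩

theorem exists_disk_disjoint (h : IsTower S P) {A : Set ℂ} (hA : IsCompact A)
    (hd : Disjoint A (towerCore S)) : ∃ N, ∀ n, N ≤ n → Disjoint A (S n).disk := by
  obtain ⟨N, hN⟩ := exists_subset_nhds_of_isCompact h.antitone_disk.directed_ge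
    (fun n => (h.valid n).isCompact_disk) (U := Aᶜ)
    (fun x hx => hA.isClosed.isOpen_compl.mem_nhds (disjoint_right.1 hd hx))
  exact ⟨N, fun n hn => disjoint_right.2 fun x hx => hN (h.antitone_disk hn hx)⟩

theorem exists_transition (h : IsTower S P) {n N : ℕ} (hnN : n ≤ N) :
    ∃ p : ℂ → ℂ, ContinuousOn p (closedBall 0 1) ∧ MapsTo p (closedBall 0 1) (closedBall 0 1) ∧
      p 0 = 0 ∧ (∀ v, (S N).J v = (S n).J (p v)) ∧
      ∀ v : ℂ, ‖v - 1‖ < (S N).ρ → ‖p v - 1‖ < (S n).ρ := by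
  induction N, hnN using Nat.le_induction with
  | base => exact ⟨id, continuousOn_id, mapsTo_id _, rfl, fun _ => rfl, fun _ hv => hv⟩
  | succ N _ ih =>
    obtain ⟨p, hpc, hpm, hp0, hpJ, hpt⟩ := ih
    have hPm : MapsTo (P N) (closedBall 0 1) (closedBall 0 1) := fun v hv =>
      mem_closedBall_zero_iff.2 ((h.step N).maps_P v (by simpa using hv)).le
    refine ⟨p ∘ P N, hpc.comp (h.step N).cont_P hPm, hpm.comp hPm, ?_, fun v => ?_, fun v hv => ?_⟩
    · simp [(h.step N).P_zero, hp0]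
    · rw [(h.step N).J_P, hpJ]; rfl
    · exact hpt _ ((h.step N).tip_P v hv)

end IsTower

/-- The pointwise limit of the maps of a tower. -/
def towerMap (S : ℕ → Stage) (z : ℂ) : ℂ := limUnder atTop fun n => (S n).f z

namespace IsTower

variable {S : ℕ → Stage} {P : ℕ → ℂ → ℂ}

theorem monotone_q (h : IsTower S P) : Monotone fun n => (S n).q := by
  refine monotone_nat_of_le_succ fun n => ?_
  obtain ⟨m, hm, hq, -⟩ := (h.step n).rot
  simp only [hq]
  exact Nat.le_mul_of_pos_right _ (by omega)

theorem tendsto_f (h : IsTower S P) {z : ℂ} (hz : z ∈ ball (0 : ℂ) 2) :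
    Tendsto (fun n => (S n).f z) atTop (nhds (towerMap S z)) := by
  apply CauchySeq.tendsto_limUnder
  apply cauchySeq_of_le_geometric (1 / 2) (1 / 64) (by norm_num)
  intro n
  rw [dist_comm, dist_eq_norm]
  have h1 := (h.step n).close z hz
  have h2 : ((1 : ℝ) / 2) ^ (n + (S n).q) ≤ (1 / 2) ^ n :=
    pow_le_pow_of_le_one (by norm_num) (by norm_num) (by omega)
  linarith

theorem norm_f_sub_towerMap_le (h : IsTower S P) {z : ℂ} (hz : z ∈ ball (0 : ℂ) 2) (N : ℕ) :
    ‖(S N).f z - towerMap S z‖ ≤ (1 / 2) ^ (N + (S N).q) / 32 := by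
  have h1 : Tendsto (fun k => (S (k + N)).f z) atTop (nhds (towerMap S z)) :=
    (tendsto_add_atTop_iff_nat N).2 (h.tendsto_f hz)
  have h2 := dist_le_of_le_geometric_of_tendsto₀ (1 / 2) ((1 / 2) ^ (N + (S N).q) / 64)
    (by norm_num) (f := fun k => (S (k + N)).f z) (fun k => ?_) h1
  · rw [dist_eq_norm] at h2
    simp only [zero_add] at h2
    refine h2.trans (le_of_eq ?_)
    ring
  · rw [dist_comm, dist_eq_norm, show k + 1 + N = k + N + 1 by ring]
    refine ((h.step (k + N)).close z hz).trans ?_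
    have h3 : (S N).q ≤ (S (k + N)).q := h.monotone_q (by omega)
    have h4 : ((1 : ℝ) / 2) ^ (k + N + (S (k + N)).q) ≤ (1 / 2) ^ (N + (S N).q + k) :=
      pow_le_pow_of_le_one (by norm_num) (by norm_num) (by omega)
    rw [pow_add _ _ k] at h4
    linarith

theorem tendstoUniformlyOn_f (h : IsTower S P) :
    TendstoUniformlyOn (fun n => (S n).f) (towerMap S) atTop (ball 0 2) := by
  rw [Metric.tendstoUniformlyOn_iff]
  intro ε hε
  have h1 : Tendsto (fun n : ℕ => ((1 : ℝ) / 2) ^ n) atTop (nhds 0) :=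
    tendsto_pow_atTop_nhds_zero_of_lt_one (by norm_num) (by norm_num)
  filter_upwards [h1.eventually_lt_const hε] with n hn z hz
  rw [dist_comm, dist_eq_norm]
  refine (h.norm_f_sub_towerMap_le hz n).trans_lt (lt_of_le_of_lt ?_ hn)
  have h2 : ((1 : ℝ) / 2) ^ (n + (S n).q) ≤ (1 / 2) ^ n :=
    pow_le_pow_of_le_one (by norm_num) (by norm_num) (by omega)
  have h3 : (0 : ℝ) < (1 / 2) ^ n := by positivity
  linarith

theorem differentiableOn_towerMap (h : IsTower S P) : DifferentiableOn ℂ (towerMap S) (ball 0 2) :=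
  h.tendstoUniformlyOn_f.tendstoLocallyUniformlyOn.differentiableOn
    (Eventually.of_forall fun n => (h.valid n).diff_f) isOpen_ball

theorem norm_towerMap_sub_le (h : IsTower S P) {z : ℂ} (hz : z ∈ ball (0 : ℂ) 2) :
    ‖towerMap S z - z‖ ≤ 1 / 16 := by
  refine le_of_tendsto ((h.tendsto_f hz).sub_const z).norm (Eventually.of_forall fun n => ?_)
  have h1 := (h.valid n).norm_f z hz
  have h2 : (0 : ℝ) < (1 / 2) ^ n := by positivity
  linarith

theorem norm_towerMap_sub_sub_le (h : IsTower S P) {x y : ℂ} (hx : x ∈ ball (0 : ℂ) (3 / 2))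
    (hy : y ∈ ball (0 : ℂ) (3 / 2)) :
    ‖(towerMap S y - y) - (towerMap S x - x)‖ ≤ 1 / 4 * ‖y - x‖ := by
  have hd : DifferentiableOn ℂ (fun z => towerMap S z - z) (ball 0 2) :=
    h.differentiableOn_towerMap.sub differentiableOn_id
  have hsub : ball (0 : ℂ) (3 / 2) ⊆ ball 0 2 := ball_subset_ball (by norm_num)
  apply (convex_ball (0 : ℂ) (3 / 2)).norm_image_sub_le_of_norm_deriv_le
    (f := fun z => towerMap S z - z) (𝕜 := ℂ) _ _ hx hy
  · exact fun z hz => hd.differentiableAt (isOpen_ball.mem_nhds (hsub hz))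
  · intro z hz
    have hcl : closedBall z (1 / 4) ⊆ ball 0 2 := by
      intro w hw
      rw [mem_closedBall, dist_eq_norm] at hw
      rw [mem_ball_zero_iff] at hz ⊢
      have := norm_add_le (w - z) z
      rw [sub_add_cancel] at this
      linarith
    have h1 := Complex.norm_deriv_le_of_forall_mem_sphere_norm_le (c := z) (R := 1 / 4)
      (C := 1 / 16) (by norm_num) (hd.diffContOnCl_ball hcl)
      (fun w hw => h.norm_towerMap_sub_le (hcl (sphere_subset_closedBall hw)))
    exact h1.trans (by norm_num)

theorem injOn_towerMap (h : IsTower S P) : InjOn (towerMap S) (ball 0 (3 / 2)) := by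
  intro x hx y hy hxy
  have h1 := h.norm_towerMap_sub_sub_le hx hy
  rw [hxy, sub_sub_sub_cancel_left, ← norm_sub_rev] at h1
  have h2 : ‖y - x‖ = 0 := by linarith [norm_nonneg (y - x)]
  exact (sub_eq_zero.1 (norm_eq_zero.1 h2)).symm

theorem dist_towerMap_le (h : IsTower S P) {x y : ℂ} (hx : x ∈ ball (0 : ℂ) (3 / 2))
    (hy : y ∈ ball (0 : ℂ) (3 / 2)) : ‖towerMap S y - towerMap S x‖ ≤ 2 * ‖y - x‖ := by
  have h1 := h.norm_towerMap_sub_sub_le hx hy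
  have h2 := norm_add_le ((towerMap S y - y) - (towerMap S x - x)) (y - x)
  rw [show (towerMap S y - y) - (towerMap S x - x) + (y - x) = towerMap S y - towerMap S x by ring]
    at h2
  linarith [norm_nonneg (y - x)]

end IsTower

namespace Stage.Valid

variable {n : ℕ} {S : Stage}

theorem norm_mult : ‖S.mult‖ = 1 := by
  rw [Stage.mult, show (2 * Real.pi * I * ((S.a : ℂ) / S.q)) =
    ((2 * Real.pi * (S.a / S.q) : ℝ) : ℂ) * I by push_cast; ring, Complex.norm_exp_ofReal_mul_I]

theorem image_f_disk (hS : S.Valid n) : S.f '' S.disk = S.disk := by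
  have h1 := norm_mult (S := S)
  have h0 : S.mult ≠ 0 := norm_pos_iff.1 (by rw [h1]; exact one_pos)
  ext z
  constructor
  · rintro ⟨_, ⟨v, hv, rfl⟩, rfl⟩
    have hv' : ‖v‖ ≤ 1 := by simpa using hv
    rw [hS.f_J v hv']
    exact ⟨_, by simpa [h1] using hv', rfl⟩
  · rintro ⟨v, hv, rfl⟩
    have hv' : ‖S.mult⁻¹ * v‖ ≤ 1 := by simpa [h1] using hv
    refine ⟨_, ⟨S.mult⁻¹ * v, by simpa using hv', rfl⟩, ?_⟩
    rw [hS.f_J _ hv', mul_inv_cancel_left₀ h0]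

theorem f_zero (hS : S.Valid n) : S.f 0 = 0 := by
  have := hS.f_J 0 (by simp)
  rwa [mul_zero, hS.J_zero] at this

theorem deriv_f_zero (hS : S.Valid n) : deriv S.f 0 = S.mult := by
  have hJ : HasDerivAt S.J (deriv S.J 0) 0 :=
    (hS.diff_J.differentiableAt (isOpen_ball.mem_nhds (hS.closedBall_subset (by simp)))).hasDerivAt
  have hf : HasDerivAt S.f (deriv S.f 0) (S.J 0) := by
    rw [hS.J_zero]
    exact (hS.diff_f.differentiableAt (isOpen_ball.mem_nhds (by simp))).hasDerivAt
  have h1 := hf.comp 0 hJ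
  have h2 : HasDerivAt (fun v => S.J (S.mult * v)) (deriv S.J 0 * S.mult) 0 := by
    have h3 : HasDerivAt (fun v : ℂ => S.mult * v) S.mult 0 := by
      simpa using (hasDerivAt_id (0 : ℂ)).const_mul S.mult
    have hJ' : HasDerivAt S.J (deriv S.J 0) (S.mult * 0) := by rwa [mul_zero]
    exact hJ'.comp 0 h3
  have h4 := h1.unique (h2.congr_of_eventuallyEq (Filter.eventuallyEq_of_mem
    (ball_mem_nhds 0 one_pos) fun v hv => hS.f_J v (by simpa using (mem_ball_zero_iff.1 hv).le)))
  rw [mul_comm] at h4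
  exact mul_left_cancel₀ hS.deriv_J h4

end Stage.Valid

namespace IsTower

variable {S : ℕ → Stage} {P : ℕ → ℂ → ℂ}

theorem towerMap_zero (h : IsTower S P) : towerMap S 0 = 0 := by
  have h1 := h.tendsto_f (z := 0) (by simp)
  simp only [(h.valid _).f_zero] at h1
  exact tendsto_nhds_unique h1 tendsto_const_nhds

theorem tendsto_mult (h : IsTower S P) :
    Tendsto (fun n => (S n).mult) atTop (nhds (deriv (towerMap S) 0)) := by
  have h1 := h.tendstoUniformlyOn_f.tendstoLocallyUniformlyOn.deriv
    (Eventually.of_forall fun n => (h.valid n).diff_f) isOpen_ball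
  have h2 := h1.tendsto_at (a := 0) (by simp)
  simpa [Function.comp_def, (h.valid _).deriv_f_zero] using h2

theorem disk_subset_ball (h : IsTower S P) (n : ℕ) : (S n).disk ⊆ ball 0 (3 / 2) := fun z hz => by
  rw [mem_ball_zero_iff]
  linarith [(h.valid n).norm_le_of_mem_disk hz]

theorem image_core (h : IsTower S P) : towerMap S '' towerCore S = towerCore S := by
  have hsub : ball (0 : ℂ) (3 / 2) ⊆ ball 0 2 := ball_subset_ball (by norm_num)
  apply Subset.antisymm
  · rintro _ ⟨z, hz, rfl⟩
    refine mem_iInter.2 fun N => ?_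
    have hzN := fun n => mem_iInter.1 hz n
    refine (h.valid N).isCompact_disk.isClosed.mem_of_tendsto
      (h.tendsto_f (hsub (h.disk_subset_ball 0 (hzN 0)))) ?_
    filter_upwards [eventually_ge_atTop N] with n hn
    apply h.antitone_disk hn
    simp only
    rw [← (h.valid n).image_f_disk]
    exact mem_image_of_mem _ (hzN n)
  · intro w hw
    have h1 : ∀ n, ∃ z ∈ (S n).disk, (S n).f z = w := fun n => by
      have := mem_iInter.1 hw n
      rwa [← (h.valid n).image_f_disk] at this
    choose z hz hzw using h1
    obtain ⟨x, hx, φ, hφ, hlim⟩ := (h.valid 0).isCompact_disk.tendsto_subseq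
      (fun n => h.antitone_disk n.zero_le (hz n))
    have hxK : x ∈ towerCore S := by
      refine mem_iInter.2 fun N => ?_
      refine (h.valid N).isCompact_disk.isClosed.mem_of_tendsto hlim ?_
      filter_upwards [eventually_ge_atTop N] with n hn
      exact h.antitone_disk (hn.trans (hφ.le_apply)) (hz (φ n))
    refine ⟨x, hxK, ?_⟩
    have hx2 : x ∈ ball (0 : ℂ) 2 := hsub (h.disk_subset_ball 0 hx)
    have h2 : Tendsto (fun n => (S (φ n)).f (z (φ n))) atTop (nhds (towerMap S x)) := by
      have h3 : TendstoUniformlyOn (fun n => (S (φ n)).f) (towerMap S) atTop (ball 0 2) :=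
        fun u hu => hφ.tendsto_atTop.eventually (h.tendstoUniformlyOn_f u hu)
      exact TendstoUniformlyOn.tendsto_comp h3 (h.differentiableOn_towerMap.continuousOn x hx2)
        (tendsto_nhdsWithin_iff.2 ⟨hlim, Eventually.of_forall fun n =>
          hsub (h.disk_subset_ball _ (hz (φ n)))⟩)
    simp only [hzw] at h2
    exact tendsto_nhds_unique h2 tendsto_const_nhds

theorem exists_rotation_number (h : IsTower S P) : ∃ α : ℝ, Irrational α ∧
    Tendsto (fun n => ((S n).a : ℝ) / (S n).q) atTop (nhds α) := by
  have hq0 : ∀ n, (0 : ℝ) < (S n).q := fun n => by exact_mod_cast (h.valid n).one_le_q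
  set x : ℕ → ℝ := fun n => ((S n).a : ℝ) / (S n).q with hx
  have hxs : ∀ n, x (n + 1) = x n + 1 / (S (n + 1)).q := by
    intro n
    obtain ⟨m, hm, hq, ha⟩ := (h.step n).rot
    have hm0 : (m : ℝ) ≠ 0 := by
      have : m ≠ 0 := by omega
      exact_mod_cast this
    have := (hq0 n).ne'
    simp only [hx, hq, ha]
    push_cast
    field_simp
  have hgrow : ∀ n k : ℕ, 1 / ((S (n + k)).q : ℝ) ≤ 1 / (S n).q * (1 / 2) ^ k := by
    intro n k
    induction k with
    | zero => simp
    | succ k ih =>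
      obtain ⟨m, hm, hq, -⟩ := (h.step (n + k)).rot
      have hm2 : (2 : ℝ) ≤ m := by
        have : 2 ≤ m := by omega
        exact_mod_cast this
      rw [← add_assoc, hq, pow_succ, ← mul_assoc]
      push_cast
      rw [← div_div, div_eq_mul_one_div _ (m : ℝ)]
      gcongr
  have hdist : ∀ n k : ℕ, dist (x (n + k)) (x (n + k + 1)) ≤ 1 / (S (n + 1)).q * (1 / 2) ^ k := by
    intro n k
    rw [hxs, Real.dist_eq, sub_add_cancel_left, abs_neg,
      abs_of_pos (one_div_pos.2 (hq0 _)), show n + k + 1 = n + 1 + k by ring]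
    exact hgrow (n + 1) k
  obtain ⟨α, hα⟩ := cauchySeq_tendsto_of_complete (cauchySeq_of_le_geometric (1 / 2)
    (1 / (S (0 + 1)).q : ℝ) (f := x) (by norm_num) fun k => by simpa using hdist 0 k)
  have hmono : StrictMono x := strictMono_nat_of_lt_succ fun n => by
    rw [hxs]
    linarith [one_div_pos.2 (hq0 (n + 1))]
  have hlt : ∀ n, x n < α := fun n =>
    (hmono n.lt_succ_self).trans_le (hmono.monotone.ge_of_tendsto hα _)
  have hle : ∀ n, α - x n ≤ 2 / (S (n + 1)).q := by
    intro n
    have h1 : Tendsto (fun k => x (n + k)) atTop (nhds α) := by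
      simp only [add_comm n]
      exact (tendsto_add_atTop_iff_nat n).2 hα
    have h2 := dist_le_of_le_geometric_of_tendsto₀ (1 / 2) (1 / (S (n + 1)).q : ℝ) (by norm_num)
      (f := fun k => x (n + k)) (fun k => hdist n k) h1
    rw [dist_comm, Real.dist_eq] at h2
    refine (le_abs_self _).trans (h2.trans (le_of_eq ?_))
    field_simp
    norm_num
  refine ⟨α, ?_, hα⟩
  rw [irrational_iff_ne_rational]
  rintro c b hb rfl
  set n := 2 * b.natAbs with hn
  obtain ⟨m, hm, hq, -⟩ := (h.step n).rot
  have h1 := hlt n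
  have h2 := hle n
  have hbR : (b : ℝ) ≠ 0 := by exact_mod_cast hb
  have hqn := hq0 n
  have h3 : (c : ℝ) / b - x n = ((c * (S n).q - (S n).a * b : ℤ) : ℝ) / (b * (S n).q) := by
    simp only [hx]
    push_cast
    field_simp
  have h4 : (c * (S n).q - (S n).a * b : ℤ) ≠ 0 := by
    intro h0
    rw [h0, Int.cast_zero, zero_div] at h3
    linarith
  have h5 : (1 : ℝ) ≤ |((c * (S n).q - (S n).a * b : ℤ) : ℝ)| := by
    exact_mod_cast Int.one_le_abs h4
  have h6 : 1 / (|(b : ℝ)| * (S n).q) ≤ (c : ℝ) / b - x n := by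
    rw [← abs_of_pos (sub_pos.2 h1), h3, abs_div, abs_mul, abs_of_pos hqn]
    gcongr
  have hm0 : (0 : ℝ) < m := by
    have : 0 < m := by omega
    exact_mod_cast this
  have hbpos : 0 < |(b : ℝ)| := abs_pos.2 hbR
  have h7 := h6.trans h2
  rw [hq] at h7
  push_cast at h7
  rw [div_le_div_iff₀ (by positivity) (by positivity)] at h7
  have h8 : (m : ℝ) ≤ 2 * |(b : ℝ)| := by
    apply le_of_mul_le_mul_left _ hqn
    linarith
  have h9 : (n : ℝ) = 2 * |(b : ℝ)| := by
    rw [hn]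
    push_cast
    rw [Nat.cast_natAbs, Int.cast_abs]
  have h10 : (n : ℝ) + 2 ≤ m := by exact_mod_cast hm
  linarith

theorem exists_irrational_deriv (h : IsTower S P) : ∃ α : ℝ, Irrational α ∧
    deriv (towerMap S) 0 = exp (2 * Real.pi * I * α) := by
  obtain ⟨α, hα, hlim⟩ := h.exists_rotation_number
  refine ⟨α, hα, tendsto_nhds_unique h.tendsto_mult ?_⟩
  have h1 : Tendsto (fun n => exp (2 * Real.pi * I * (((S n).a : ℝ) / (S n).q : ℝ))) atTop
      (nhds (exp (2 * Real.pi * I * α))) := by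
    have hc : Continuous fun x : ℝ => exp (2 * Real.pi * I * (x : ℂ)) := by fun_prop
    exact (hc.tendsto α).comp hlim
  refine h1.congr fun n => ?_
  simp [Stage.mult]

end IsTower

theorem Linearizable.exists_stable {α : ℝ} {f : ℂ → ℂ} (hf : Linearizable α f) {ε : ℝ}
    (hε : 0 < ε) : ∃ η > 0, ∀ z : ℂ, ‖z‖ < η → ∀ k : ℕ, ‖f^[k] z‖ < ε := by
  obtain ⟨h, V, hVo, h0V, hd, hinj, h0, hconj⟩ := hf
  set l : ℂ := exp (2 * Real.pi * I * α) with hl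
  have hl1 : ‖l‖ = 1 := by
    rw [hl, show (2 * Real.pi * I * α : ℂ) = ((2 * Real.pi * α : ℝ) : ℂ) * I by push_cast; ring,
      Complex.norm_exp_ofReal_mul_I]
  have hcont : ContinuousAt h 0 := (hd.differentiableAt (hVo.mem_nhds h0V)).continuousAt
  have hsmall : ∀ᶠ w in nhds (0 : ℂ), ‖h w‖ < ε := by
    have := hcont.norm.eventually_lt_const (u := ε) (by simpa [h0] using hε)
    exact this
  obtain ⟨δ, hδ, hball⟩ := Metric.eventually_nhds_iff_ball.1
    ((hVo.eventually_mem h0V).and (hconj.and hsmall))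
  have hsub : ball (0 : ℂ) δ ⊆ V := fun w hw => (hball w hw).1
  have hopen : IsOpen (h '' ball 0 δ) := by
    rcases ((hd.mono hsub).analyticOnNhd isOpen_ball).is_constant_or_isOpen
      (convex_ball _ _).isPreconnected with ⟨w, hw⟩ | ho
    · exfalso
      have hh : ((δ / 2 : ℝ) : ℂ) ∈ ball (0 : ℂ) δ := by
        rw [mem_ball_zero_iff, Complex.norm_real, Real.norm_eq_abs, abs_of_pos (by positivity)]
        linarith
      have h00 : (0 : ℂ) ∈ ball (0 : ℂ) δ := mem_ball_self hδ
      have := hinj (hsub hh) (hsub h00) ((hw _ hh).trans (hw _ h00).symm)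
      have h2 : δ / 2 = 0 := by exact_mod_cast this
      linarith
    · exact ho _ Subset.rfl isOpen_ball
  obtain ⟨η, hη, hηsub⟩ := Metric.isOpen_iff.1 hopen 0 ⟨0, mem_ball_self hδ, h0⟩
  refine ⟨η, hη, fun z hz k => ?_⟩
  obtain ⟨w, hw, rfl⟩ := hηsub (mem_ball_zero_iff.2 hz)
  have hmem : ∀ k, l ^ k * w ∈ ball (0 : ℂ) δ := fun k => by
    rw [mem_ball_zero_iff, norm_mul, norm_pow, hl1, one_pow, one_mul]
    exact mem_ball_zero_iff.1 hw
  have hiter : f^[k] (h w) = h (l ^ k * w) := by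
    induction k with
    | zero => simp
    | succ k ih =>
      rw [Function.iterate_succ_apply', ih, (hball _ (hmem k)).2.1, pow_succ', mul_assoc]
  rw [hiter]
  exact (hball _ (hmem k)).2.2

theorem IsTower.not_linearizable {S : ℕ → Stage} {P : ℕ → ℂ → ℂ} (h : IsTower S P) (α : ℝ) :
    ¬ Linearizable α (towerMap S) := by
  intro hlin
  obtain ⟨η, hη, hstab⟩ := hlin.exists_stable (ε := 1 / 4) (by norm_num)
  obtain ⟨n, hn⟩ := exists_nat_one_div_lt hη
  obtain ⟨v, hv, hvn, k, hk, hesc⟩ := (h.step n).escape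
  set z := (S (n + 1)).J v with hz
  have hsub : ball (0 : ℂ) (3 / 2) ⊆ ball 0 2 := ball_subset_ball (by norm_num)
  have hmem1 : ∀ j, (towerMap S)^[j] z ∈ ball (0 : ℂ) (3 / 2) := fun j => by
    rw [mem_ball_zero_iff]
    linarith [hstab z (hvn.trans hn) j]
  have hmem2 : ∀ j, (S (n + 1)).f^[j] z ∈ (S (n + 1)).disk := by
    intro j
    induction j with
    | zero => exact ⟨v, by simp [hv], rfl⟩
    | succ j ih =>
      rw [Function.iterate_succ_apply', ← (h.valid (n + 1)).image_f_disk]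
      exact mem_image_of_mem _ ih
  set κ : ℝ := (1 / 2) ^ (S (n + 1)).q / 32 with hκ
  have herr : ∀ j, ‖(S (n + 1)).f^[j] z - (towerMap S)^[j] z‖ ≤ κ * (2 ^ j - 1) := by
    intro j
    induction j with
    | zero => simp
    | succ j ih =>
      rw [Function.iterate_succ_apply', Function.iterate_succ_apply']
      have hw := h.disk_subset_ball _ (hmem2 j)
      have h1 := h.norm_f_sub_towerMap_le (hsub hw) (n + 1)
      have h2 := h.dist_towerMap_le (hmem1 j) hw
      have h3 : ((1 : ℝ) / 2) ^ (n + 1 + (S (n + 1)).q) ≤ (1 / 2) ^ (S (n + 1)).q :=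
        pow_le_pow_of_le_one (by norm_num) (by norm_num) (by omega)
      have h4 := norm_sub_le_norm_sub_add_norm_sub ((S (n + 1)).f ((S (n + 1)).f^[j] z))
        (towerMap S ((S (n + 1)).f^[j] z)) (towerMap S ((towerMap S)^[j] z))
      have h5 : κ * (2 ^ (j + 1) - 1) = 2 * (κ * (2 ^ j - 1)) + κ := by ring
      rw [h5]
      linarith
  have h1 := herr k
  have h2 : κ * (2 ^ k - 1) ≤ 1 / 32 := by
    have h3 : (2 : ℝ) ^ k ≤ 2 ^ (S (n + 1)).q := pow_le_pow_right₀ (by norm_num) hk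
    have h4 : κ * 2 ^ (S (n + 1)).q = 1 / 32 := by
      rw [hκ, div_mul_eq_mul_div, ← mul_pow]
      norm_num
    have h5 : 0 < κ := by positivity
    rw [← h4]
    exact mul_le_mul_of_nonneg_left (by linarith) h5.le
  have h3 := hstab z (hvn.trans hn) k
  have h4 := norm_sub_norm_le ((S (n + 1)).f^[k] z) ((towerMap S)^[k] z)
  linarith

theorem Stage.Valid.continuousOn_invFunOn_J {n : ℕ} {S : Stage} (hS : S.Valid n) :
    ContinuousOn (Function.invFunOn S.J (ball 0 S.R)) (S.J '' ball 0 S.R) := by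
  rw [_root_.continuousOn_iff']
  intro t ht
  refine ⟨S.J '' (t ∩ ball 0 S.R), hS.isOpen_image_J inter_subset_right (ht.inter isOpen_ball), ?_⟩
  ext z
  constructor
  · rintro ⟨hzt, hz⟩
    exact ⟨⟨_, ⟨hzt, Function.invFunOn_mem hz⟩, Function.invFunOn_eq hz⟩, hz⟩
  · rintro ⟨⟨v, ⟨hvt, hv⟩, rfl⟩, hz⟩
    refine ⟨?_, hz⟩
    rw [mem_preimage, hS.inj_J.leftInvOn_invFunOn hv]
    exact hvt

theorem Stage.Valid.exists_lift {n : ℕ} {S : Stage} (hS : S.Valid n) {γ : ℝ → ℂ} {t₀ : ℝ}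
    (ht₀ : t₀ ≤ 1) (hγ : ContinuousOn γ (Icc t₀ 1)) (hγ1 : γ 1 = 0) (hγ0 : γ t₀ ∉ S.disk) :
    ∃ s ∈ Ico t₀ 1, ∃ Γ : ℝ → ℂ, ContinuousOn Γ (Icc s 1) ∧ ‖Γ s‖ = 1 ∧ Γ 1 = 0 ∧
      ∀ t ∈ Icc s 1, ‖Γ t‖ ≤ 1 ∧ S.J (Γ t) = γ t := by
  have hb : ball (0 : ℂ) 1 ⊆ ball 0 S.R := ball_subset_ball hS.one_lt_R.le
  have hopen : IsOpen (S.J '' ball 0 1) := hS.isOpen_image_J hb isOpen_ball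
  have hcpt : IsCompact (Icc t₀ 1 ∩ γ ⁻¹' (S.J '' ball 0 1)ᶜ) :=
    isCompact_Icc.of_isClosed_subset
      (hγ.preimage_isClosed_of_isClosed isClosed_Icc hopen.isClosed_compl) inter_subset_left
  obtain ⟨s, ⟨hs, hsJ⟩, hmax⟩ := hcpt.exists_isGreatest
    ⟨t₀, ⟨le_rfl, ht₀⟩, fun h => hγ0 (image_mono ball_subset_closedBall h)⟩
  have hs1 : s < 1 := lt_of_le_of_ne hs.2 (by
    rintro rfl
    exact hsJ ⟨0, by simp, by rw [hS.J_zero, hγ1]⟩)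
  have hin : ∀ t ∈ Ioc s 1, γ t ∈ S.J '' ball 0 1 := by
    intro t ht
    by_contra hn
    exact absurd (hmax ⟨⟨hs.1.trans ht.1.le, ht.2⟩, hn⟩) (not_le.2 ht.1)
  have hsub : Icc s 1 ⊆ Icc t₀ 1 := Icc_subset_Icc_left hs.1
  have hdisk : ∀ t ∈ Icc s 1, γ t ∈ S.disk := by
    have hmaps : MapsTo γ (closure (Ioc s 1)) (closure S.disk) := by
      refine MapsTo.closure_of_continuousOn
        (fun t ht => image_mono ball_subset_closedBall (hin t ht)) ?_
      rw [closure_Ioc hs1.ne]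
      exact hγ.mono hsub
    rw [closure_Ioc hs1.ne, hS.isCompact_disk.isClosed.closure_eq] at hmaps
    exact hmaps
  have hdR : S.disk ⊆ S.J '' ball 0 S.R := image_mono hS.closedBall_subset
  have hJΓ : ∀ t ∈ Icc s 1, S.J (Function.invFunOn S.J (ball 0 S.R) (γ t)) = γ t :=
    fun t ht => Function.invFunOn_eq (hdR (hdisk t ht))
  have hnorm : ∀ t ∈ Icc s 1, ‖Function.invFunOn S.J (ball 0 S.R) (γ t)‖ ≤ 1 := by
    intro t ht
    obtain ⟨v, hv, hvt⟩ := hdisk t ht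
    rw [← hvt, hS.inj_J.leftInvOn_invFunOn (hS.closedBall_subset hv)]
    simpa using hv
  have hsI : s ∈ Icc s 1 := ⟨le_rfl, hs1.le⟩
  refine ⟨s, ⟨hs.1, hs1⟩, fun t => Function.invFunOn S.J (ball 0 S.R) (γ t),
    hS.continuousOn_invFunOn_J.comp (hγ.mono hsub) fun t ht => hdR (hdisk t ht), ?_, ?_,
    fun t ht => ⟨hnorm t ht, hJΓ t ht⟩⟩
  · refine le_antisymm (hnorm s hsI) ?_
    by_contra! hlt
    exact hsJ ⟨_, mem_ball_zero_iff.2 hlt, hJΓ s hsI⟩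
  · simp only [hγ1]
    have h0 : (0 : ℂ) ∈ ball (0 : ℂ) S.R := hS.closedBall_subset (by simp)
    have h1 := hS.inj_J.leftInvOn_invFunOn h0
    rwa [hS.J_zero] at h1

theorem exists_eq_of_spiral {Γ ℓ : ℝ → ℂ} {s t a ε ρ : ℝ} (hst : s ≤ t) (ha1 : a ≤ 1)
    (hε : ε < 1) (hερ : ε < ρ) (hΓ : ContinuousOn Γ (Icc s t)) (hΓs : ‖Γ s‖ = 1)
    (hΓt : ‖Γ t‖ = 1 - ε) (hΓb : ∀ u ∈ Icc s t, 1 - ε ≤ ‖Γ u‖ ∧ ‖Γ u‖ ≤ 1)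
    (hΓ1 : ∀ u ∈ Icc s t, ρ ≤ ‖Γ u - 1‖) (hℓ : ContinuousOn ℓ (Icc a 1))
    (hℓb : ∀ x ∈ Icc a 1, 1 - ε < ‖exp (ℓ x)‖ ∧ ‖exp (ℓ x)‖ < 1)
    (hturn : (ℓ a).im + 4 * Real.pi ≤ (ℓ 1).im) :
    ∃ x ∈ Icc a 1, ∃ u ∈ Icc s t, exp (ℓ x) = Γ u := by
  have hpi := Real.pi_pos
  have hΓ0 : ∀ u ∈ Icc s t, Γ u ≠ 0 := fun u hu => norm_pos_iff.1 (by linarith [(hΓb u hu).1])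
  have hslit : ∀ u ∈ Icc s t, -Γ u ∈ slitPlane := by
    intro u hu
    by_contra hn
    rw [mem_slitPlane_iff, not_or, not_lt, not_not, neg_re, neg_im, neg_eq_zero, neg_nonpos] at hn
    have h1 : Γ u = ((Γ u).re : ℂ) := Complex.ext rfl (by simp [hn.2])
    have h2 := hΓb u hu
    have h3 := hΓ1 u hu
    rw [h1, Complex.norm_real, Real.norm_eq_abs, abs_of_nonneg hn.1] at h2
    rw [h1, ← Complex.ofReal_one, ← Complex.ofReal_sub, Complex.norm_real, Real.norm_eq_abs,
      abs_of_nonpos (by linarith)] at h3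
    linarith
  set k : ℤ := ⌈(ℓ a).im / (2 * Real.pi)⌉ with hk
  have hk1 : (ℓ a).im ≤ 2 * Real.pi * k := by
    have := Int.le_ceil ((ℓ a).im / (2 * Real.pi))
    rw [div_le_iff₀ (by positivity)] at this
    rw [hk]; linarith
  have hk2 : 2 * Real.pi * k < (ℓ a).im + 2 * Real.pi := by
    have := Int.ceil_lt_add_one ((ℓ a).im / (2 * Real.pi))
    rw [← sub_lt_iff_lt_add, lt_div_iff₀ (by positivity)] at this
    rw [hk]; linarith
  set G : ℝ → ℂ := fun u => log (-Γ u) + ((Real.pi + 2 * Real.pi * k : ℝ) : ℂ) * I with hG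
  have hGc : ContinuousOn G (Icc s t) := (hΓ.neg.clog hslit).add_const _
  have hGim : ∀ u, (G u).im = arg (-Γ u) + (Real.pi + 2 * Real.pi * k) := fun u => by
    simp [hG, Complex.log_im]
  have hGre : ∀ u, (G u).re = Real.log ‖Γ u‖ := fun u => by
    simp [hG, Complex.log_re]
  have hGexp : ∀ u ∈ Icc s t, exp (G u) = Γ u := by
    intro u hu
    have h1 : ((Real.pi + 2 * Real.pi * k : ℝ) : ℂ) * I = Real.pi * I + k * (2 * Real.pi * I) := by
      push_cast; ring
    simp only [hG]
    rw [Complex.exp_add, Complex.exp_log (neg_ne_zero.2 (hΓ0 u hu)), h1, Complex.exp_add,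
      Complex.exp_pi_mul_I, Complex.exp_int_mul_two_pi_mul_I]
    ring
  have hℓre : ∀ x, (ℓ x).re = Real.log ‖exp (ℓ x)‖ := fun x => by
    rw [Complex.norm_exp, Real.log_exp]
  obtain ⟨x, hx, u, hu, hxu⟩ := exists_zero_of_sides (D := fun x u => ℓ x - G u) ha1 hst
    ((hℓ.comp continuousOn_fst fun x hx => hx.1).sub (hGc.comp continuousOn_snd fun x hx => hx.2))
    (fun u _ => by
      rw [Complex.sub_im, hGim]
      linarith [Complex.neg_pi_lt_arg (-Γ u)])
    (fun u _ => by
      rw [Complex.sub_im, hGim]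
      linarith [Complex.arg_le_pi (-Γ u)])
    (fun x hx => by
      rw [Complex.sub_re, hGre, hΓs, Real.log_one, sub_zero, hℓre]
      exact Real.log_neg (norm_pos_iff.2 (Complex.exp_ne_zero _)) (hℓb x hx).2)
    (fun x hx => by
      rw [Complex.sub_re, hGre, hΓt, hℓre, sub_pos]
      exact Real.log_lt_log (by linarith) (hℓb x hx).1)
  refine ⟨x, hx, u, hu, ?_⟩
  rw [sub_eq_zero.1 hxu, hGexp u hu]

theorem IsTower.not_accessiblePoint {S : ℕ → Stage} {P : ℕ → ℂ → ℂ} (h : IsTower S P) :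
    ¬ AccessiblePoint (towerCore S) 0 := by
  rintro ⟨γ, hγ, hγ1, hγK⟩
  obtain ⟨t₀, ht₀, hsmall⟩ : ∃ t₀ ∈ Ico (0 : ℝ) 1, ∀ t ∈ Icc t₀ 1, ‖γ t‖ < 1 / 2 := by
    obtain ⟨δ, hδ, hd⟩ := Metric.continuousOn_iff.1 hγ 1 ⟨zero_le_one, le_rfl⟩ (1 / 2) (by norm_num)
    refine ⟨max 0 (1 - δ / 2), ⟨le_max_left _ _, max_lt one_pos (by linarith)⟩, fun t ht => ?_⟩
    have h1 := (le_max_left _ _).trans ht.1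
    have h2 := (le_max_right _ _).trans ht.1
    have h3 := hd t ⟨h1, ht.2⟩ (by
      rw [Real.dist_eq, abs_sub_lt_iff]; constructor <;> linarith [ht.2])
    rwa [hγ1, dist_zero_right] at h3
  obtain ⟨n, hn⟩ : ∃ n, γ t₀ ∉ (S n).disk := by
    have := hγK t₀ ht₀
    simpa [towerCore] using this
  have hV := h.valid n
  obtain ⟨s, hs, Γ, hΓ, hΓs, hΓ1, hΓJ⟩ := hV.exists_lift ht₀.2.le
    (hγ.mono (Icc_subset_Icc_left ht₀.1)) hγ1 hn
  obtain ⟨ε, hε, hερ, hε1, hspiral⟩ := (h.step n).spiral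
  have hrev : MapsTo (fun u : ℝ => s + 1 - u) (Icc s 1) (Icc s 1) := fun u hu =>
    ⟨by linarith [hu.2], by linarith [hu.1]⟩
  obtain ⟨u, hu, hue, hgt⟩ := exists_last_time (f := fun u => ‖Γ (s + 1 - u)‖) (c := 1 - ε) hs.2.le
    ((hΓ.comp (by fun_prop) hrev).norm) (by simp [hΓ1]; linarith) (by simp [hΓs]; linarith)
  set t₁ := s + 1 - u with ht₁
  have hst₁ : s ≤ t₁ := by linarith [hu.2]
  have ht₁1 : t₁ < 1 := by
    refine lt_of_le_of_ne (by linarith [hu.1]) fun h1 => ?_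
    rw [h1, hΓ1, norm_zero] at hue
    linarith
  have hsub : Icc s t₁ ⊆ Icc s 1 := Icc_subset_Icc_right ht₁1.le
  have hst0 : 0 ≤ s := ht₀.1.trans hs.1
  have hge : ∀ t ∈ Icc s t₁, 1 - ε ≤ ‖Γ t‖ := by
    intro t ht
    rcases eq_or_lt_of_le ht.2 with rfl | hlt
    · exact hue.ge
    · have := hgt (s + 1 - t) ⟨by linarith, by linarith [ht.1]⟩
      rw [sub_sub_cancel] at this
      exact this.le
  have htip : ∀ t ∈ Icc s t₁, (S n).ρ ≤ ‖Γ t - 1‖ := by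
    intro t ht
    by_contra! hlt
    obtain ⟨h1, h2⟩ := hΓJ t (hsub ht)
    have h3 := hV.tip_J _ h1 hlt
    rw [h2] at h3
    exact absurd (hsmall t ⟨hs.1.trans ht.1, ht.2.trans ht₁1.le⟩) (not_lt.2 h3)
  have hcpt : IsCompact (γ '' Icc s t₁) := isCompact_Icc.image_of_continuousOn
    (hγ.mono (Icc_subset_Icc hst0 ht₁1.le))
  have hdisj : Disjoint (γ '' Icc s t₁) (towerCore S) := by
    rw [disjoint_left]
    rintro _ ⟨t, ht, rfl⟩
    exact hγK t ⟨hst0.trans ht.1, ht.2.trans_lt ht₁1⟩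
  obtain ⟨N, hN⟩ := h.exists_disk_disjoint hcpt hdisj
  set M := max N (n + 1) with hM
  obtain ⟨p, hpc, hpm, hp0, hpJ, hpt⟩ := h.exists_transition (le_max_right N (n + 1))
  have hreal : MapsTo (fun x : ℝ => (x : ℂ)) (Icc 0 1) (closedBall 0 1) := fun x hx => by
    rw [mem_closedBall_zero_iff, Complex.norm_real, Real.norm_eq_abs, abs_of_nonneg hx.1]
    exact hx.2
  obtain ⟨a, ha, ℓ, hℓ, hℓP, hturn⟩ := hspiral (fun x => p x)
    (hpc.comp Complex.continuous_ofReal.continuousOn hreal) (hpm.comp hreal) (by simp [hp0])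
    (by
      rw [Complex.ofReal_one]
      exact hpt 1 (by simpa using (h.valid _).ρ_pos))
  have hsubA : Icc a 1 ⊆ Icc (0 : ℝ) 1 := Icc_subset_Icc_left ha.1
  obtain ⟨x, hx, t, ht, hxt⟩ := exists_eq_of_spiral hst₁ ha.2.le hε1 hερ (hΓ.mono hsub) hΓs hue
    (fun t ht => ⟨hge t ht, (hΓJ t (hsub ht)).1⟩) htip hℓ
    (fun x hx => by
      rw [(hℓP x hx).1]
      exact ⟨(hℓP x hx).2, (h.step n).maps_P _ (by simpa using hpm (hreal (hsubA hx)))⟩) hturn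
  rw [(hℓP x hx).1] at hxt
  have h1 : γ t = (S M).J x := by
    rw [hpJ, (h.step n).J_P, hxt, (hΓJ t (hsub ht)).2]
  exact disjoint_left.1 (hN M (le_max_left _ _)) (mem_image_of_mem γ ht)
    (h1 ▸ mem_image_of_mem _ (hreal (hsubA hx)))

/-- There exists a non-linearizable germ with a hedgehog whose fixed point `0` is
inaccessible from the complement of the hedgehog. -/
theorem exists_hedgehog_inaccessible_fixed_point :
    ∃ (α r : ℝ) (f : ℂ → ℂ) (U K : Set ℂ),
      Irrational α ∧ 0 < r ∧
      IsOpen U ∧ Metric.closedBall (0 : ℂ) r ⊆ U ∧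
      DifferentiableOn ℂ f U ∧ Set.InjOn f U ∧
      f 0 = 0 ∧ deriv f 0 = Complex.exp (2 * Real.pi * Complex.I * α) ∧
      ¬ Linearizable α f ∧
      IsHedgehog r f K ∧
      ¬ AccessiblePoint K 0 := by
  obtain ⟨S, P, h⟩ := exists_isTower
  obtain ⟨α, hα, hder⟩ := h.exists_irrational_deriv
  obtain ⟨w, hw, hmax⟩ := h.isCompact_core.exists_isMaxOn ⟨0, h.zero_mem_core⟩
    continuous_norm.continuousOn
  obtain ⟨z, hz, hz2⟩ := h.exists_mem_core_half_le_norm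
  have hzw : ‖z‖ ≤ ‖w‖ := hmax hz
  refine ⟨α, ‖w‖, towerMap S, ball 0 (3 / 2), towerCore S, hα, by linarith, isOpen_ball,
    closedBall_subset_ball (by linarith [h.norm_le_of_mem_core hw]),
    h.differentiableOn_towerMap.mono (ball_subset_ball (by norm_num)), h.injOn_towerMap,
    h.towerMap_zero, hder, h.not_linearizable α,
    ⟨h.isCompact_core, h.isConnected_core, h.zero_mem_core, fun x hx => ?_,
      ⟨w, hw, by simp⟩, h.image_core, h.isConnected_compl_core⟩, h.not_accessiblePoint⟩
  exact mem_closedBall_zero_iff.2 (hmax hx)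
end
end

section
/- Let g be an entire function, let Ψ be an entire function with Ψ'(z) = exp(g(E(z))) for all z ∈ ℂ, and let M > 0. Then there exist δ > 0 and C > 0 such that for every real t with |t| < δ there is an injective holomorphic map F_t : ℍ_{−M} → ℂ satisfying Ψ(F_t(z)) = Ψ(z) + t and |F_t(z) − z| ≤ C|t| for all z ∈ ℍ_{−M}. -/
open Complex Metric Set Filter

noncomputable section

/-- The universal covering `E(z) = e^{2πiz}` of `ℂ*`. -/
def E (z : ℂ) : ℂ := Complex.exp (2 * Real.pi * Complex.I * z)

theorem norm_E_le {R : ℝ} {z : ℂ} (hz : -R ≤ z.im) : ‖E z‖ ≤ Real.exp (2 * Real.pi * R) := by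
  rw [E, Complex.norm_exp]
  apply Real.exp_le_exp.mpr
  have h : (2 * (Real.pi : ℂ) * Complex.I * z).re = 2 * Real.pi * (-z.im) := by
    simp [Complex.mul_re, Complex.mul_im]
  rw [h]
  have := Real.pi_pos
  gcongr
  linarith

theorem E_add (z w : ℂ) : E (z + w) = E z * E w := by
  simp only [E, mul_add, Complex.exp_add]

/-- Translation by a small amount moves `E` uniformly little on a half-plane. -/
theorem exists_norm_E_sub_lt (M : ℝ) {η : ℝ} (hη : 0 < η) :
    ∃ r > 0, ∀ z w : ℂ, -M < z.im → ‖w - z‖ < r → ‖E w - E z‖ < η := by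
  set R := Real.exp (2 * Real.pi * M)
  have hR : 0 < R := Real.exp_pos _
  have hc : ContinuousAt E 0 := by unfold E; fun_prop
  obtain ⟨r, hr, h⟩ := Metric.continuousAt_iff.mp hc (η / R) (by positivity)
  refine ⟨r, hr, fun z w hz hw => ?_⟩
  have h1 : ‖E (w - z) - 1‖ < η / R := by
    have := @h (w - z) (by simpa using hw)
    simpa [dist_eq_norm, E] using this
  have h2 : E w - E z = E z * (E (w - z) - 1) := by
    rw [mul_sub, ← E_add]; simp
  rw [h2, norm_mul]
  calc ‖E z‖ * ‖E (w - z) - 1‖ ≤ R * ‖E (w - z) - 1‖ := by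
        gcongr; exact norm_E_le hz.le
    _ < R * (η / R) := by gcongr
    _ = η := by field_simp

/-- A map whose derivative is close to its value at the centre of a ball expands distances
on that ball by a definite amount. -/
theorem mul_norm_sub_le_of_norm_deriv_sub_le {f : ℂ → ℂ} (hf : Differentiable ℂ f) {z : ℂ}
    {r m ε : ℝ} (hm : m + ε ≤ ‖deriv f z‖) (h : ∀ w ∈ ball z r, ‖deriv f w - deriv f z‖ ≤ ε)
    {u v : ℂ} (hu : u ∈ ball z r) (hv : v ∈ ball z r) :
    m * ‖u - v‖ ≤ ‖f u - f v‖ := by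
  have key : ‖(f u - deriv f z * u) - (f v - deriv f z * v)‖ ≤ ε * ‖u - v‖ := by
    refine (convex_ball z r).norm_image_sub_le_of_norm_hasDerivWithin_le
      (f := fun x => f x - deriv f z * x) (f' := fun x => deriv f x - deriv f z)
      (fun x _ => ?_) h hv hu
    have hd := (hf x).hasDerivAt.sub ((hasDerivAt_id x).const_mul (deriv f z))
    rw [mul_one] at hd
    exact hd.hasDerivWithinAt
  have h1 : deriv f z * (u - v) =
      (f u - f v) - ((f u - deriv f z * u) - (f v - deriv f z * v)) := by ring
  have h2 : ‖deriv f z‖ * ‖u - v‖ ≤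
      ‖f u - f v‖ + ‖(f u - deriv f z * u) - (f v - deriv f z * v)‖ := by
    rw [← norm_mul, h1]; exact norm_sub_le _ _
  have h3 := mul_le_mul_of_nonneg_right hm (norm_nonneg (u - v))
  linarith

/-- If an entire function `f` is uniformly expanding on balls of fixed radius centred in an
open set `S`, then translations in the image lift to univalent maps of `S`. -/
theorem exists_univalent_lift_of_locally_expanding {f : ℂ → ℂ} (hf : Differentiable ℂ f)
    (hf' : ∀ z, deriv f z ≠ 0) {S : Set ℂ} (hS : IsOpen S) {r m : ℝ} (hr : 0 < r) (hm : 0 < m)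
    (h : ∀ z ∈ S, ∀ u ∈ ball z r, ∀ v ∈ ball z r, m * ‖u - v‖ ≤ ‖f u - f v‖)
    {t : ℂ} (ht : ‖t‖ < m * r / 4) :
    ∃ F : ℂ → ℂ, DifferentiableOn ℂ F S ∧ InjOn F S ∧
      ∀ z ∈ S, f (F z) = f z + t ∧ ‖F z - z‖ ≤ 1 / m * ‖t‖ := by
  have hinj : ∀ z ∈ S, InjOn f (ball z r) := fun z hz u hu v hv huv => by
    have h1 := h z hz u hu v hv
    rw [huv, sub_self, norm_zero] at h1
    exact sub_eq_zero.mp (norm_le_zero_iff.mp (nonpos_of_mul_nonpos_right h1 hm))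
  have hex : ∀ z ∈ S, ∃ w ∈ ball z r, f w = f z + t := fun z hz => by
    have hfreq : ∃ᶠ w in nhds z, f w ≠ f z :=
      ((hf z).hasDerivAt.eventually_ne (hf' z)).frequently.filter_mono nhdsWithin_le_nhds
    have hsub := (hf.diffContOnCl (s := ball z (r / 2))).ball_subset_image_closedBall
      (ε := m * (r / 2)) (half_pos hr) (fun w hw => by
        have hw' : ‖w - z‖ = r / 2 := by simpa [dist_eq_norm] using hw
        have h1 := h z hz w (by rw [mem_ball, dist_eq_norm]; linarith) z (mem_ball_self hr)
        rwa [hw'] at h1) hfreq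
    obtain ⟨w, hw, hwt⟩ := hsub (show f z + t ∈ ball (f z) (m * (r / 2) / 2) by
      rw [mem_ball, dist_eq_norm, add_sub_cancel_left]; linarith)
    exact ⟨w, closedBall_subset_ball (half_lt_self hr) hw, hwt⟩
  choose! F hFmem hF using hex
  have hbound : ∀ z ∈ S, ‖F z - z‖ ≤ 1 / m * ‖t‖ := fun z hz => by
    have h1 := h z hz _ (hFmem z hz) z (mem_ball_self hr)
    rw [hF z hz, add_sub_cancel_left] at h1
    rw [one_div, ← div_eq_inv_mul, le_div_iff₀ hm]
    linarith
  have hsmall : 1 / m * ‖t‖ < r / 4 := by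
    rw [one_div, ← div_eq_inv_mul, div_lt_iff₀ hm]
    linarith
  refine ⟨F, fun z hz => ?_, fun z hz w hw hzw => ?_, fun z hz => ⟨hF z hz, hbound z hz⟩⟩
  · have hsd : HasStrictDerivAt f (deriv f (F z)) (F z) :=
      (hf.analyticAt (F z)).hasStrictDerivAt
    set φ := hsd.localInverse f _ _ (hf' _)
    have hφ : HasStrictDerivAt φ (deriv f (F z))⁻¹ (f (F z)) := hsd.to_localInverse (hf' _)
    have hφz : φ (f (F z)) = F z := (hsd.eventually_left_inverse (hf' _)).self_of_nhds
    have hright : ∀ᶠ y in nhds (f (F z)), f (φ y) = y := hsd.eventually_right_inverse (hf' _)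
    rw [hF z hz] at hφ hφz hright
    have hG : DifferentiableAt ℂ (fun x => φ (f x + t)) z :=
      DifferentiableAt.comp (f := fun x => f x + t) z hφ.hasDerivAt.differentiableAt
        ((hf z).add_const t)
    have htend : Tendsto (fun x => f x + t) (nhds z) (nhds (f z + t)) :=
      ((hf z).add_const t).continuousAt
    have hball : ∀ᶠ x in nhds z, φ (f x + t) ∈ ball x r := by
      have hd : ContinuousAt (fun x => dist (φ (f x + t)) x) z :=
        hG.continuousAt.dist continuousAt_id
      refine hd.eventually_lt continuousAt_const ?_
      simpa [hφz] using hFmem z hz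
    have heq : F =ᶠ[nhds z] fun x => φ (f x + t) := by
      filter_upwards [hball, htend.eventually hright, hS.mem_nhds hz] with x hx1 hx2 hx3
      exact hinj x hx3 (hFmem x hx3) hx1 ((hF x hx3).trans hx2.symm)
    exact (hG.congr_of_eventuallyEq heq).differentiableWithinAt
  · have h1 := hbound z hz
    have h2 := hbound w hw
    have hfzw : f w = f z := by
      have h3 := hF w hw
      rw [← hzw, hF z hz] at h3
      exact (add_right_cancel h3).symm
    have hdist : ‖w - z‖ < r := by
      have h3 : w - z = (F z - z) - (F w - w) := by rw [hzw]; ring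
      have h4 := norm_sub_le (F z - z) (F w - w)
      rw [← h3] at h4
      linarith
    exact (hinj z hz (by rwa [mem_ball, dist_eq_norm]) (mem_ball_self hr) hfzw).symm

/-- If `Ψ` is entire with `Ψ'(z) = exp(g(E(z)))` for an entire `g`, and `M > 0`, then
there are `δ, C > 0` such that for `|t| < δ` the time-`t` flow maps `F_t` of the
vector field `Ψ_* ∂/∂z` (characterized by `Ψ ∘ F_t = Ψ + t`) are defined and injective
on the half-plane `ℍ_{-M}` and move points by at most `C|t|`. -/
theorem flow_maps_univalent_on_half_plane
    (g Ψ : ℂ → ℂ) (hg : Differentiable ℂ g) (hΨ : Differentiable ℂ Ψ)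
    (hΨ' : ∀ z : ℂ, deriv Ψ z = Complex.exp (g (E z)))
    (M : ℝ) (hM : 0 < M) :
    ∃ δ C : ℝ, 0 < δ ∧ 0 < C ∧
      ∀ t : ℝ, |t| < δ →
        ∃ F : ℂ → ℂ,
          DifferentiableOn ℂ F {z : ℂ | -M < z.im} ∧
          Set.InjOn F {z : ℂ | -M < z.im} ∧
          ∀ z ∈ {z : ℂ | -M < z.im},
            Ψ (F z) = Ψ z + t ∧ ‖F z - z‖ ≤ C * |t| := by
  set K : Set ℂ := closedBall 0 (Real.exp (2 * Real.pi * (M + 1)))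
  have hK : IsCompact K := isCompact_closedBall _ _
  have hcont : Continuous fun x => Complex.exp (g x) := Complex.continuous_exp.comp hg.continuous
  obtain ⟨x₀, -, hx₀⟩ := hK.exists_isMinOn ⟨0, mem_closedBall_self (Real.exp_pos _).le⟩
    hcont.norm.continuousOn
  set m := ‖Complex.exp (g x₀)‖
  have hm : 0 < m := norm_pos_iff.mpr (Complex.exp_ne_zero _)
  have hEK : ∀ z : ℂ, -(M + 1) ≤ z.im → E z ∈ K := fun z hz => by
    simpa [K] using norm_E_le hz
  obtain ⟨η, hη, huc⟩ := Metric.uniformContinuousOn_iff.mp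
    (hK.uniformContinuousOn_of_continuous hcont.continuousOn) (m / 2) (half_pos hm)
  obtain ⟨r, hr, hE⟩ := exists_norm_E_sub_lt M hη
  have hr' : 0 < min r 1 := lt_min hr one_pos
  have hexp : ∀ z ∈ {z : ℂ | -M < z.im}, ∀ u ∈ ball z (min r 1), ∀ v ∈ ball z (min r 1),
      m / 2 * ‖u - v‖ ≤ ‖Ψ u - Ψ v‖ := by
    intro z (hz : -M < z.im) u hu v hv
    have hzK : E z ∈ K := hEK z (by linarith)
    refine mul_norm_sub_le_of_norm_deriv_sub_le hΨ (ε := m / 2) ?_ (fun w hw => ?_) hu hv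
    · rw [add_halves, hΨ']
      exact hx₀ hzK
    · rw [mem_ball, dist_eq_norm, lt_min_iff] at hw
      have him := (abs_lt.mp ((Complex.abs_im_le_norm (w - z)).trans_lt hw.2)).1
      rw [Complex.sub_im] at him
      rw [hΨ', hΨ', ← dist_eq_norm]
      exact (huc _ (hEK w (by linarith)) _ hzK
        (by rw [dist_eq_norm]; exact hE z w hz hw.1)).le
  refine ⟨m / 2 * min r 1 / 4, 1 / (m / 2), by positivity, by positivity, fun t ht => ?_⟩
  have hnorm : ‖(t : ℂ)‖ = |t| := by simp
  have hlift := exists_univalent_lift_of_locally_expanding hΨ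
    (fun z => by rw [hΨ']; exact Complex.exp_ne_zero _)
    (isOpen_lt continuous_const Complex.continuous_im) hr' (half_pos hm) hexp
    (t := t) (by rwa [hnorm])
  rwa [hnorm] at hlift
end
end

section
/- Let A ⊆ ℝ be a set having 0 as an accumulation point, and let (f_s)_{s ∈ A} be holomorphic injective maps on the unit disk 𝔻 with f_s(0) = 0 and f_s'(0) = e^{2πis}, commuting pairwise on a neighborhood of 0. Fix t ∈ ℝ. If g and h are holomorphic injective maps on 𝔻 with g(0) = h(0) = 0, g'(0) = h'(0) = e^{2πit}, and if for every s ∈ A each of g and h commutes with f_s on a neighborhood of 0, then g = h on 𝔻. -/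
open Complex Metric Set Filter

noncomputable section

open Topology Asymptotics

/-- If `g` and `h` both commute with `f` near the common fixed point `0`, and `g - h` vanishes
to order exactly `n` there, then the multiplier `c` of `f` satisfies `c ^ n = c`. -/
theorem multiplier_pow_eq_self_of_commute {f g h k : ℂ → ℂ} {c : ℂ} {n : ℕ}
    (hf : HasStrictDerivAt f c 0) (hf0 : f 0 = 0)
    (hg : ContinuousAt g 0) (hg0 : g 0 = 0) (hh : ContinuousAt h 0) (hh0 : h 0 = 0)
    (hk : ContinuousAt k 0) (hk0 : k 0 ≠ 0)
    (hgh : ∀ᶠ z in 𝓝 (0 : ℂ), g z - h z = z ^ n * k z)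
    (hgf : ∀ᶠ z in 𝓝 (0 : ℂ), g (f z) = f (g z))
    (hhf : ∀ᶠ z in 𝓝 (0 : ℂ), h (f z) = f (h z)) : c ^ n = c := by
  have hfc : Tendsto f (𝓝 0) (𝓝 0) := by
    simpa [ContinuousAt, hf0] using hf.hasDerivAt.continuousAt
  have hle : 𝓝[≠] (0 : ℂ) ≤ 𝓝 0 := nhdsWithin_le_nhds
  have hk_ne : ∀ᶠ z in 𝓝[≠] (0 : ℂ), k z ≠ 0 := hle (hk.eventually_ne hk0)
  have hpair : Tendsto (fun z => (g z, h z)) (𝓝[≠] 0) (𝓝 ((0 : ℂ), (0 : ℂ))) := by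
    have := (hg.tendsto.prodMk_nhds hh.tendsto).mono_left hle
    rwa [hg0, hh0] at this
  have h_zero : Tendsto
      (fun z => (f (g z) - f (h z) - (g z - h z) * c) / (g z - h z)) (𝓝[≠] 0) (𝓝 0) := by
    simpa [Function.comp_def] using
      (hf.isLittleO.comp_tendsto hpair).tendsto_div_nhds_zero
  have h_slope : Tendsto (fun z => f z / z) (𝓝[≠] 0) (𝓝 c) := by
    have := hf.hasDerivAt.tendsto_slope
    refine this.congr fun z => ?_
    simp [slope_def_field, hf0]
  have h_pow : Tendsto (fun z => (f z / z) ^ n * (k (f z) / k z) - c) (𝓝[≠] 0)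
      (𝓝 (c ^ n * (k 0 / k 0) - c)) :=
    ((h_slope.pow n).mul (((hk.tendsto.comp hfc).mono_left hle).div
      (hk.tendsto.mono_left hle) hk0)).sub_const c
  have h_eq : (fun z => (f (g z) - f (h z) - (g z - h z) * c) / (g z - h z)) =ᶠ[𝓝[≠] 0]
      fun z => (f z / z) ^ n * (k (f z) / k z) - c := by
    filter_upwards [hk_ne, hle hgh, hle (hfc.eventually hgh), hle hgf, hle hhf,
      self_mem_nhdsWithin] with z h1 h2 h3 h4 h5 h6
    have hz : z ≠ 0 := h6
    rw [← h4, ← h5, h3, h2, div_pow]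
    field_simp
  have := tendsto_nhds_unique (h_zero.congr' h_eq) h_pow
  rw [div_self hk0, mul_one] at this
  exact sub_eq_zero.1 this.symm

/-- An analytic function vanishing together with its derivative at `0`, but not identically
near `0`, has a zero of finite order at least two. -/
theorem exists_eventually_eq_pow_mul_of_deriv_eq_zero {D : ℂ → ℂ} (hD : AnalyticAt ℂ D 0)
    (hD0 : D 0 = 0) (hD' : deriv D 0 = 0) (hne : ¬ ∀ᶠ z in 𝓝 (0 : ℂ), D z = 0) :
    ∃ (m : ℕ) (k : ℂ → ℂ), ContinuousAt k 0 ∧ k 0 ≠ 0 ∧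
      ∀ᶠ z in 𝓝 (0 : ℂ), D z = z ^ (m + 2) * k z := by
  obtain ⟨n, k, hk, hk0, heq⟩ := hD.exists_eventuallyEq_pow_smul_nonzero_iff.2 hne
  simp only [sub_zero, smul_eq_mul] at heq
  match n, heq with
  | 0, heq => exact absurd (by simpa [hD0] using heq.self_of_nhds.symm) hk0
  | 1, heq =>
    have hderiv : HasDerivAt (fun z => z ^ 1 * k z) (k 0) 0 := by
      simpa using
        (hasDerivAt_id (0 : ℂ)).fun_mul hk.differentiableAt.hasDerivAt
    exact absurd (((hderiv.congr_of_eventuallyEq heq).deriv).symm.trans hD') hk0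
  | m + 2, heq => exact ⟨m, k, hk.continuousAt, hk0, heq⟩

/-- If `exp (2πis)` is a root of unity of order dividing `m + 1` and `|s| (m + 1) < 1`,
then `s = 0`. -/
theorem eq_zero_of_exp_pow_eq_self {s : ℝ} {m : ℕ}
    (h : Complex.exp (2 * Real.pi * Complex.I * s) ^ (m + 2) =
      Complex.exp (2 * Real.pi * Complex.I * s))
    (hs : |s| * (m + 1) < 1) : s = 0 := by
  have h1 : Complex.exp (((m + 1 : ℕ) : ℂ) * (2 * Real.pi * Complex.I * s)) = 1 := by
    rw [Complex.exp_nat_mul]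
    refine mul_right_cancel₀ (Complex.exp_ne_zero (2 * Real.pi * Complex.I * s)) ?_
    rw [← pow_succ, h, one_mul]
  obtain ⟨j, hj⟩ := Complex.exp_eq_one_iff.1 h1
  have hj' : s * (m + 1) = j := by
    have : ((s * (m + 1) : ℝ) : ℂ) = ((j : ℝ) : ℂ) := by
      refine mul_right_cancel₀ Complex.two_pi_I_ne_zero ?_
      push_cast at hj ⊢
      linear_combination hj
    exact_mod_cast this
  have hm : (0 : ℝ) < m + 1 := by positivity
  have hj0 : j = 0 := by
    rw [← Int.abs_lt_one_iff]
    have : |(j : ℝ)| < 1 := by rwa [← hj', abs_mul, abs_of_pos hm]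
    exact_mod_cast this
  rw [hj0, Int.cast_zero] at hj'
  exact (mul_eq_zero.1 hj').resolve_right hm.ne'

/-- A map commuting near `0` with a family of commuting univalent maps `(f_s)_{s ∈ A}`
on the unit disk, where `A` accumulates at `0`, is determined on the unit disk by its
derivative at `0`. -/
theorem commuting_germ_unique
    (A : Set ℝ) (hA : (0 : ℝ) ∈ closure (A \ {0}))
    (f : ℝ → ℂ → ℂ)
    (hf : ∀ s ∈ A,
      DifferentiableOn ℂ (f s) (Metric.ball 0 1) ∧
      Set.InjOn (f s) (Metric.ball 0 1) ∧
      f s 0 = 0 ∧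
      deriv (f s) 0 = Complex.exp (2 * Real.pi * Complex.I * s))
    (hcomm : ∀ s ∈ A, ∀ s' ∈ A, ∀ᶠ z in nhds (0 : ℂ), f s (f s' z) = f s' (f s z))
    (t : ℝ) (g h : ℂ → ℂ)
    (hgd : DifferentiableOn ℂ g (Metric.ball 0 1))
    (hgi : Set.InjOn g (Metric.ball 0 1))
    (hg0 : g 0 = 0)
    (hg' : deriv g 0 = Complex.exp (2 * Real.pi * Complex.I * t))
    (hhd : DifferentiableOn ℂ h (Metric.ball 0 1))
    (hhi : Set.InjOn h (Metric.ball 0 1))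
    (hh0 : h 0 = 0)
    (hh' : deriv h 0 = Complex.exp (2 * Real.pi * Complex.I * t))
    (hgc : ∀ s ∈ A, ∀ᶠ z in nhds (0 : ℂ), g (f s z) = f s (g z))
    (hhc : ∀ s ∈ A, ∀ᶠ z in nhds (0 : ℂ), h (f s z) = f s (h z)) :
    Set.EqOn g h (Metric.ball 0 1) := by
  have hball : Metric.ball (0 : ℂ) 1 ∈ 𝓝 0 := Metric.ball_mem_nhds 0 one_pos
  have hga := hgd.analyticAt hball
  have hha := hhd.analyticAt hball
  refine (hgd.analyticOnNhd Metric.isOpen_ball).eqOn_of_preconnected_of_eventuallyEq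
    (hhd.analyticOnNhd Metric.isOpen_ball) (convex_ball 0 1).isPreconnected
    (Metric.mem_ball_self one_pos) ?_
  by_contra hne
  obtain ⟨m, k, hk, hk0, heq⟩ := exists_eventually_eq_pow_mul_of_deriv_eq_zero (hga.sub hha)
    (by simp [hg0, hh0])
    (by rw [deriv_sub hga.differentiableAt hha.differentiableAt, hg', hh', sub_self])
    (fun H => hne (H.mono fun z hz => sub_eq_zero.1 hz))
  have hm : (0 : ℝ) < m + 1 := by positivity
  obtain ⟨s, ⟨hsA, hs0⟩, hs⟩ := Metric.mem_closure_iff.1 hA (1 / (m + 1)) (by positivity)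
  obtain ⟨hfd, -, hf0, hf'⟩ := hf s hsA
  have hfs := (hfd.analyticAt hball).hasStrictDerivAt
  rw [hf'] at hfs
  refine hs0 (eq_zero_of_exp_pow_eq_self (multiplier_pow_eq_self_of_commute hfs hf0
    hga.continuousAt hg0 hha.continuousAt hh0 hk hk0 heq (hgc s hsA) (hhc s hsA)) ?_)
  rwa [Real.dist_eq, zero_sub, abs_neg, lt_div_iff₀ hm] at hs
end
end
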